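/- arXiv:1512.07126 — 2 statements merged into one kernel-verified Lean document; each statement's English description precedes it below -/
import Mathlib

section
/- There exist a constant C > 0 and a threshold N such that for all integers n ≥ 1 and k ≥ N, c(n,k) ≤ ℓ(n,k+1) ≤ (k / exp(C · (log k)^{1/7})) · 2^n. -/
open Pointwise

noncomputable section

/-- The set of lattice (integer) points in `ℝ^n`. -/
def lat (n : ℕ) : Set (Fin n → ℝ) := {x | ∀ j, ∃ z : ℤ, x j = (z : ℝ)}

/-- The polyhedron determined by the subsystem of `A x ≤ b` indexed by `I`. -/
def polyI {n m : ℕ} (A : Fin m → Fin n → ℝ) (b : Fin m → ℝ) (I : Set (Fin m)) :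
    Set (Fin n → ℝ) := {x | ∀ i ∈ I, ∑ j, A i j * x j ≤ b i}

/-- The integer points of a set `S ⊆ ℝ^n`. -/
def intPts {n : ℕ} (S : Set (Fin n → ℝ)) : Set (Fin n → ℝ) := S ∩ lat n

/-- `c` is a valid Helly-type bound for dimension `n` and `k` integer points:
any polyhedron with exactly `k` integer points has a subsystem of at most `c`
inequalities with exactly the same integer points. -/
def HellyBound (n k c : ℕ) : Prop :=
  ∀ (m : ℕ) (A : Fin m → Fin n → ℝ) (b : Fin m → ℝ),
    (intPts (polyI A b Set.univ)).Finite →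
    (intPts (polyI A b Set.univ)).ncard = k →
    ∃ I : Finset (Fin m), I.card ≤ c ∧
      intPts (polyI A b (↑I : Set (Fin m))) = intPts (polyI A b Set.univ)

/-- The quantity `c(n,k)`: the least valid Helly-type bound. -/
def cnk (n k : ℕ) : ℕ := sInf {c | HellyBound n k c}

/-- A set of points is in convex position if no point of it lies in the convex
hull of the others. -/
def ConvexPos {n : ℕ} (V : Set (Fin n → ℝ)) : Prop :=
  ∀ v ∈ V, v ∉ convexHull ℝ (V \ {v})

/-- `iconv V = conv(V) ∩ ℤ^n`. -/
def iconv {n : ℕ} (V : Set (Fin n → ℝ)) : Set (Fin n → ℝ) :=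
  convexHull ℝ V ∩ lat n

/-- `ℓ(n,k)`: the smallest integer `s` such that every set `V ⊆ ℤ^n` in convex
position with `|V| = s` satisfies `|iconv(V) \ V| ≥ k`. -/
def ellnk (n k : ℕ) : ℕ :=
  sInf {s | ∀ V : Set (Fin n → ℝ), V ⊆ lat n → ConvexPos V → V.Finite →
    V.ncard = s → k ≤ (iconv V \ V).ncard}

/-- The set of midpoints of `V` that are not in `V`. -/
def midpts {n : ℕ} (V : Set (Fin n → ℝ)) : Set (Fin n → ℝ) :=
  {p | ∃ x ∈ V, ∃ y ∈ V, p = (1/2 : ℝ) • (x + y)} \ V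

/-- `μ_c(n,s)`: the minimum number of midpoints `|M(V)|` over all sets
`V ⊆ ℝ^n` in convex position with `|V| = s`. -/
def muc (n s : ℕ) : ℕ :=
  sInf {m | ∃ V : Set (Fin n → ℝ), ConvexPos V ∧ V.Finite ∧ V.ncard = s ∧
    (midpts V).ncard = m}

/-- `α(n,k)`: the maximum cardinality of a set `V ⊆ ℤ^n` in convex position
with `|iconv(V) \ V| = k`. -/
def alphank (n k : ℕ) : ℕ :=
  sSup {m | ∃ V : Set (Fin n → ℝ), V ⊆ lat n ∧ ConvexPos V ∧ V.Finite ∧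
    V.ncard = m ∧ (iconv V \ V).ncard = k}

/-- A system `A x ≤ b` is non-redundant if removing any single inequality
strictly increases the set of integer points. -/
def NonRedundant {n m : ℕ} (A : Fin m → Fin n → ℝ) (b : Fin m → ℝ) : Prop :=
  ∀ i : Fin m,
    intPts (polyI A b Set.univ) ⊂ intPts (polyI A b ({i}ᶜ : Set (Fin m)))

/-- The set of lattice (integer) points in Euclidean space `ℝ^n`. -/
def latE (n : ℕ) : Set (EuclideanSpace ℝ (Fin n)) := {x | ∀ j, ∃ z : ℤ, x j = (z : ℝ)}


/-! ### Additive combinatorics part -/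

section Comb

variable {G : Type*} [AddCommGroup G] [DecidableEq G]

/-- Dilates of small doubling sets. -/
lemma dil_bound [IsAddTorsionFree G] (A : Finset G) (hA : A.Nonempty) (K : ℝ)
    (hK : ((A + A).card : ℝ) ≤ K * A.card) (J : ℕ) :
    ((A - A.image (fun x => (2 ^ (J+1) : ℕ) • x)).card : ℝ) ≤ (K ^ 3) ^ (J+1) * A.card := by
  have hpos : (0 : ℝ) < A.card := by exact_mod_cast hA.card_pos
  have hK0 : 0 ≤ K := by
    by_contra h
    push Not at h
    have : K * A.card < 0 := mul_neg_of_neg_of_pos h hpos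
    have h2 : (0:ℝ) ≤ ((A + A).card : ℝ) := by positivity
    linarith
  have base : ∀ i : ℕ, ((A.image (fun x => (2 ^ i : ℕ) • x)
      - A.image (fun x => (2 ^ (i+1) : ℕ) • x)).card : ℝ) ≤ K ^ 3 * A.card := by
    intro i
    have h1 : A.image (fun x => (2 ^ i : ℕ) • x) - A.image (fun x => (2 ^ (i+1) : ℕ) • x)
        ⊆ (1 • A - 2 • A).image (fun x => (2 ^ i : ℕ) • x) := by
      intro z hz
      obtain ⟨a, ha, b, hb, rfl⟩ := Finset.mem_sub.1 hz
      obtain ⟨a', ha', rfl⟩ := Finset.mem_image.1 ha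
      obtain ⟨b', hb', rfl⟩ := Finset.mem_image.1 hb
      refine Finset.mem_image.2 ⟨a' - (b' + b'), ?_, ?_⟩
      · rw [one_smul, two_smul]
        exact Finset.sub_mem_sub ha' (Finset.add_mem_add hb' hb')
      · simp only [smul_sub, pow_succ, mul_smul, two_smul]
    have h2 : ((1 • A - 2 • A).card : ℝ) ≤ K ^ 3 * A.card := by
      have := Finset.pluennecke_ruzsa_inequality_nsmul_sub_nsmul_add hA A 1 2
      have h3 : ((1 • A - 2 • A).card : ℝ) ≤ (((A+A).card : ℝ) / A.card) ^ (1+2) * A.card := by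
        have h := (NNRat.cast_le (K := ℝ)).2 this
        push_cast at h
        exact h
      refine h3.trans ?_
      norm_num
      gcongr
      rwa [div_le_iff₀ hpos]
    refine le_trans ?_ h2
    exact_mod_cast (Finset.card_le_card h1).trans Finset.card_image_le
  induction J with
  | zero => simpa using base 0
  | succ J ih =>
    have tri := Finset.ruzsa_triangle_inequality_sub_sub_sub A
      (A.image (fun x => (2 ^ (J+1) : ℕ) • x)) (A.image (fun x => (2 ^ (J+1+1) : ℕ) • x))
    have hc : (A.image (fun x => (2 ^ (J+1) : ℕ) • x)).card = A.card := by
      apply Finset.card_image_of_injective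
      exact nsmul_right_injective (by positivity)
    rw [hc, ← Finset.card_neg (Finset.image _ A - Finset.image (fun x => (2 ^ (J+1) : ℕ) • x) A), neg_sub] at tri
    have tri' : ((A - A.image (fun x => (2 ^ (J+1+1) : ℕ) • x)).card : ℝ) * A.card ≤
      ((A - A.image (fun x => (2 ^ (J+1) : ℕ) • x)).card : ℝ) *
      ((A.image (fun x => (2 ^ (J+1) : ℕ) • x)
      - A.image (fun x => (2 ^ (J+1+1) : ℕ) • x)).card : ℝ) := by exact_mod_cast tri
    have h4 := mul_le_mul ih (base (J+1)) (by positivity) (by positivity)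
    have h5 := tri'.trans h4
    rw [pow_succ (K^3) (J+1)]
    refine le_of_mul_le_mul_right (h5.trans (le_of_eq ?_)) hpos
    ring

/-- A large set of small doubling has two points congruent modulo `2^(J+1)`. -/
lemma exists_congr_pair [IsAddTorsionFree G] (A : Finset G) (hA : A.Nonempty) (K : ℝ)
    (hK : ((A + A).card : ℝ) ≤ K * A.card) (J : ℕ) (hlarge : (K ^ 3) ^ (J+1) < A.card) :
    ∃ p ∈ A, ∃ q ∈ A, p ≠ q ∧ ∃ v, q - p = (2 ^ (J+1) : ℕ) • v := by
  by_contra hcon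
  push Not at hcon
  have hpos : (0 : ℝ) < A.card := by exact_mod_cast hA.card_pos
  have hb := dil_bound A hA K hK J
  have hcard : (A - A.image (fun x => (2 ^ (J+1) : ℕ) • x)).card = A.card * A.card := by
    rw [← Finset.card_product]
    symm
    apply Finset.card_bij (fun x _ => x.1 - (2 ^ (J+1) : ℕ) • x.2)
    · intro x hx
      rw [Finset.mem_product] at hx
      exact Finset.sub_mem_sub hx.1 (Finset.mem_image_of_mem _ hx.2)
    · rintro ⟨a, b⟩ hx ⟨c, d⟩ hy h
      rw [Finset.mem_product] at hx hy
      simp only at h hx hy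
      have h1 : c - a = (2 ^ (J+1) : ℕ) • (d - b) := by
        rw [smul_sub, sub_eq_sub_iff_add_eq_add]
        rw [sub_eq_sub_iff_add_eq_add] at h
        rw [← h, add_comm]
      by_cases hac : a = c
      · subst hac
        have : b = d := by
          apply nsmul_right_injective (n := 2 ^ (J+1)) (by positivity)
          simpa using h
        rw [this]
      · exact absurd h1 (hcon a hx.1 c hy.1 hac _)
    · intro z hz
      obtain ⟨a, ha, b, hb, rfl⟩ := Finset.mem_sub.1 hz
      obtain ⟨b', hb', rfl⟩ := Finset.mem_image.1 hb
      exact ⟨(a, b'), Finset.mem_product.2 ⟨ha, hb'⟩, rfl⟩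
  rw [hcard] at hb
  push_cast at hb
  have := le_of_mul_le_mul_right hb hpos
  linarith

/-- The core combinatorial estimate. -/
lemma core_comb [IsAddTorsionFree G] (A B : Finset G) (m k J : ℕ) (hA : A.card = m)
    (hB : B.card ≤ k)
    (h1 : ∀ a ∈ A, ∀ b ∈ A, a ≠ b → ∃ x ∈ B, a + b = 2 • x)
    (h2 : ∀ p ∈ A, ∀ q ∈ A, ∀ s ∈ A, p ≠ q → s ≠ p → s ≠ q → ∀ v, q - p = (2 ^ (J+1) : ℕ) • v →
      ∀ i : ℕ, i < 2 ^ J → ∃ y ∈ B, s + p + (2 * i) • v = 2 • y)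
    (h3 : ∀ a ∈ A, ∀ v : G, v ≠ 0 → ∀ i j : ℕ, 0 < i → i < j → a + i • v ∈ A → a + j • v ∈ A → False)
    (hm : 0 < m)
    (hlarge : ((((k : ℝ) + m) / m) ^ 3) ^ (J+1) < m) : (m - 2) * 2 ^ J ≤ 2 * k := by
  have hAne : A.Nonempty := by rw [← Finset.card_pos]; omega
  have hmpos : (0 : ℝ) < m := by exact_mod_cast hm
  have hK : ((A + A).card : ℝ) ≤ (((k : ℝ) + m) / m) * A.card := by
    rw [hA, div_mul_cancel₀ _ hmpos.ne']
    have hsub : A + A ⊆ (B ∪ A).image (fun x => 2 • x) := by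
      intro z hz
      obtain ⟨a, ha, b, hb, rfl⟩ := Finset.mem_add.1 hz
      by_cases hab : a = b
      · subst hab
        exact Finset.mem_image.2 ⟨a, Finset.mem_union_right _ ha, two_smul _ _⟩
      · obtain ⟨x, hx, hx'⟩ := h1 a ha b hb hab
        exact Finset.mem_image.2 ⟨x, Finset.mem_union_left _ hx, hx'.symm⟩
    have h := ((Finset.card_le_card hsub).trans Finset.card_image_le).trans
      (Finset.card_union_le _ _)
    have : (A + A).card ≤ k + m := by omega
    exact_mod_cast this
  obtain ⟨p, hp, q, hq, hpq, v, hv⟩ := exists_congr_pair A hAne _ hK J (by rw [hA]; exact hlarge)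
  have hv0 : v ≠ 0 := by
    rintro rfl
    rw [smul_zero, sub_eq_zero] at hv
    exact hpq hv.symm
  set S := (A.erase p).erase q with hS
  have hScard : m - 2 ≤ S.card := by
    have := Finset.pred_card_le_card_erase (s := A) (a := p)
    have := Finset.pred_card_le_card_erase (s := A.erase p) (a := q)
    rw [← hS] at this
    omega
  set T := S ×ˢ Finset.range (2 ^ J) with hT
  have hTc : T.card = S.card * 2 ^ J := by rw [hT, Finset.card_product, Finset.card_range]
  have hfib := Finset.card_le_mul_card_image (f := fun x : G × ℕ => x.1 + p + (2 * x.2) • v) T 2 (by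
    intro y _
    by_contra hcard
    push Not at hcard
    obtain ⟨⟨a, i⟩, ⟨b, j⟩, ⟨c, l⟩, ha, hb, hc, hab, hac, hbc⟩ := Finset.two_lt_card_iff.1 hcard
    simp only [Finset.mem_filter, hT, Finset.mem_product, hS, Finset.mem_erase] at ha hb hc
    obtain ⟨⟨⟨-, -, ha⟩, -⟩, ha'⟩ := ha
    obtain ⟨⟨⟨-, -, hb⟩, -⟩, hb'⟩ := hb
    obtain ⟨⟨⟨-, -, hc⟩, -⟩, hc'⟩ := hc
    have key : ∀ (a b : G) (i j : ℕ), a + p + (2 * i) • v = y → b + p + (2 * j) • v = y → i ≤ j →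
        a = b + (2 * (j - i)) • v := by
      intro a b i j h h' hij
      obtain ⟨d, rfl⟩ := Nat.exists_eq_add_of_le hij
      have h4 : a + p + (2 * i) • v = b + p + (2 * (i + d)) • v := h.trans h'.symm
      rw [mul_add, add_smul] at h4
      have : (b + p + ((2 * i) • v + (2 * d) • v)) = (b + (2 * d) • v) + p + (2 * i) • v := by abel
      rw [this] at h4
      have h5 := add_right_cancel (add_right_cancel h4)
      simpa using h5
    have main : ∀ (a b c : G) (i j l : ℕ), a ∈ A → b ∈ A → c ∈ A →
        a + p + (2 * i) • v = y → b + p + (2 * j) • v = y → c + p + (2 * l) • v = y →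
        i < j → j < l → False := by
      intro a b c i j l ha hb hc h h' h'' hij hjl
      refine h3 c hc v hv0 (2 * (l - j)) (2 * (l - i)) (by omega) (by omega) ?_ ?_
      · rw [← key b c j l h' h'' hjl.le]; exact hb
      · rw [← key a c i l h h'' (hij.trans hjl).le]; exact ha
    have ne : ∀ (a b : G) (i j : ℕ), a + p + (2 * i) • v = y → b + p + (2 * j) • v = y →
        (a, i) ≠ (b, j) → i ≠ j := by
      intro a b i j h h' hne hij
      subst hij
      exact hne (by rw [show a = b by simpa using key a b i i h h' le_rfl])
    have hij := ne a b i j ha' hb' hab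
    have hil := ne a c i l ha' hc' hac
    have hjl := ne b c j l hb' hc' hbc
    rcases lt_or_gt_of_ne hij with h | h <;> rcases lt_or_gt_of_ne hil with h' | h' <;>
      rcases lt_or_gt_of_ne hjl with h'' | h''
    · exact main _ _ _ _ _ _ ha hb hc ha' hb' hc' h h''
    · exact main _ _ _ _ _ _ ha hc hb ha' hc' hb' h' h''
    · omega
    · exact main _ _ _ _ _ _ hc ha hb hc' ha' hb' h' h
    · exact main _ _ _ _ _ _ hb ha hc hb' ha' hc' h h'
    · omega
    · exact main _ _ _ _ _ _ hb hc ha hb' hc' ha' h'' h'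
    · exact main _ _ _ _ _ _ hc hb ha hc' hb' ha' h'' h)
  have himg : (T.image (fun x : G × ℕ => x.1 + p + (2 * x.2) • v)).card ≤ k := by
    have hsub : T.image (fun x : G × ℕ => x.1 + p + (2 * x.2) • v) ⊆ B.image (fun x => 2 • x) := by
      intro z hz
      obtain ⟨⟨s, i⟩, hx, rfl⟩ := Finset.mem_image.1 hz
      simp only [hT, Finset.mem_product, hS, Finset.mem_erase, Finset.mem_range] at hx
      obtain ⟨⟨hsq, hsp, hs⟩, hi⟩ := hx
      obtain ⟨y, hy, hy'⟩ := h2 p hp q hq s hs hpq hsp hsq v hv i hi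
      exact Finset.mem_image.2 ⟨y, hy, hy'.symm⟩
    exact ((Finset.card_le_card hsub).trans Finset.card_image_le).trans hB
  calc (m - 2) * 2 ^ J ≤ S.card * 2 ^ J := Nat.mul_le_mul_right _ hScard
    _ = T.card := hTc.symm
    _ ≤ _ := hfib
    _ ≤ 2 * k := Nat.mul_le_mul_left _ himg

end Comb

/-! ### Geometry -/

section Geom

variable {n : ℕ}

/-- The embedding of integer vectors in real vectors. -/
def toR (x : Fin n → ℤ) : Fin n → ℝ := fun j => (x j : ℝ)

lemma toR_inj : Function.Injective (toR (n := n)) := by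
  intro x y h
  funext j
  have := congrFun h j
  simpa [toR] using this

lemma mem_lat_iff (x : Fin n → ℝ) : x ∈ lat n ↔ x ∈ Set.range (toR (n := n)) := by
  constructor
  · intro h
    choose z hz using h
    exact ⟨z, funext fun j => (hz j).symm⟩
  · rintro ⟨z, rfl⟩ j
    exact ⟨z j, rfl⟩

lemma finite_bdd_lat (S : Set (Fin n → ℝ)) (hS : Bornology.IsBounded S) : (S ∩ lat n).Finite := by
  obtain ⟨R, hR⟩ := hS.exists_norm_le
  refine ((Set.finite_Icc (fun _ => -⌈R⌉ : Fin n → ℤ) (fun _ => ⌈R⌉)).image toR).subset ?_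
  rintro x ⟨hx, hx'⟩
  obtain ⟨z, rfl⟩ := (mem_lat_iff x).1 hx'
  refine ⟨z, ?_, rfl⟩
  have h := hR _ hx
  have h' : ∀ j, |(z j : ℝ)| ≤ R := fun j => (norm_le_pi_norm (toR z) j).trans h
  constructor
  · intro j
    have := (abs_le.1 (h' j)).1
    have h3 : (-⌈R⌉ : ℝ) ≤ z j := by linarith [Int.le_ceil R]
    exact_mod_cast h3
  · intro j
    have := (abs_le.1 (h' j)).2
    have h3 : (z j : ℝ) ≤ ⌈R⌉ := by linarith [Int.le_ceil R]
    exact_mod_cast h3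

lemma iconv_finite (V : Set (Fin n → ℝ)) (hV : V.Finite) : (iconv V).Finite :=
  finite_bdd_lat _ (isBounded_convexHull.2 hV.isBounded)

lemma ConvexPos.mono {V W : Set (Fin n → ℝ)} (hV : ConvexPos V) (h : W ⊆ V) : ConvexPos W :=
  fun v hv hv' => hV v (h hv) (convexHull_mono (Set.sdiff_subset_sdiff_left h) hv')

lemma ConvexPos.extreme {V : Set (Fin n → ℝ)} (hV : ConvexPos V) {v : Fin n → ℝ} (hv : v ∈ V) :
    v ∈ (convexHull ℝ V).extremePoints ℝ := by
  by_contra hcon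
  -- the set conv V minus v
  have hsub : convexHull ℝ V = convexJoin ℝ {v} (convexHull ℝ (V \ {v})) ∨ V \ {v} = ∅ := by
    by_cases hne : (V \ {v}).Nonempty
    · left
      conv_lhs => rw [← Set.insert_sdiff_self_of_mem hv]
      rw [convexHull_insert hne]
    · right
      exact Set.not_nonempty_iff_eq_empty.1 hne
  rcases hsub with hsub | hsub
  · apply hcon
    rw [mem_extremePoints]
    refine ⟨subset_convexHull ℝ V hv, ?_⟩
    intro x hx y hy hxy
    have hvn := hV v hv
    rw [hsub, mem_convexJoin] at hx hy
    obtain ⟨v1, hv1, x', hx', hx⟩ := hx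
    obtain ⟨v2, hv2, y', hy', hy⟩ := hy
    rw [Set.mem_singleton_iff] at hv1 hv2
    subst v1; subst v2
    obtain ⟨a, b, ha, hb, hab, rfl⟩ := hx
    obtain ⟨c, d, hc, hd, hcd, rfl⟩ := hy
    obtain ⟨s, t, hs, ht, hst, hv'⟩ := hxy
    have hz : s * b + t * d = 0 := by
      by_contra hne
      have hpos : 0 < s * b + t * d := lt_of_le_of_ne (by positivity) (Ne.symm hne)
      apply hvn
      have hcv := convex_convexHull ℝ (V \ {v}) hx' hy'
        (show 0 ≤ s * b / (s * b + t * d) by positivity)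
        (show 0 ≤ t * d / (s * b + t * d) by positivity) (by field_simp)
      convert hcv using 1
      have ha' : a = 1 - b := by linarith
      have hc' : c = 1 - d := by linarith
      have ht' : t = 1 - s := by linarith
      funext j
      have hj := congrFun hv' j
      simp only [Pi.add_apply, Pi.smul_apply, smul_eq_mul] at hj ⊢
      have : (s * b + t * d) * v j = s * b * x' j + t * d * y' j := by
        subst ha' hc' ht'
        linear_combination (-1 : ℝ) * hj
      field_simp
      linarith
    have hb0 : b = 0 := by
      have h1 : 0 ≤ s * b := by positivity
      have h2 : 0 ≤ t * d := by positivity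
      have h3 : s * b = 0 := by linarith
      rcases mul_eq_zero.1 h3 with h | h
      · linarith
      · exact h
    have hd0 : d = 0 := by
      have h1 : 0 ≤ s * b := by positivity
      have h2 : 0 ≤ t * d := by positivity
      have h3 : t * d = 0 := by linarith
      rcases mul_eq_zero.1 h3 with h | h
      · linarith
      · exact h
    subst hb0 hd0
    rw [add_zero] at hab hcd
    subst hab hcd
    simp
  · apply hcon
    have : V = {v} := by
      apply Set.Subset.antisymm
      · exact Set.sdiff_eq_empty.1 hsub
      · simpa using hv
    rw [this]
    simp

/-- A midpoint of a vertex `s` and a different point of the hull is not a vertex. -/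
lemma midpoint_notMem {V : Set (Fin n → ℝ)} (hV : ConvexPos V) {s r y : Fin n → ℝ}
    (hs : s ∈ convexHull ℝ V) (hr : r ∈ convexHull ℝ V) (hsr : s ≠ r) (hy : s + r = (2:ℝ) • y) :
    y ∈ convexHull ℝ V ∧ y ∉ V := by
  have hy2 : y = (1/2 : ℝ) • s + (1/2 : ℝ) • r := by
    rw [← smul_add, hy, smul_smul]; norm_num
  constructor
  · rw [hy2]
    exact convex_convexHull ℝ V hs hr (by norm_num) (by norm_num) (by norm_num)
  · intro hyV
    have hext := hV.extreme hyV
    rw [mem_extremePoints] at hext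
    have := hext.2 s hs r hr ⟨1/2, 1/2, by norm_num, by norm_num, by norm_num, hy2.symm⟩
    exact hsr (this.1.trans this.2.symm)

end Geom

/-- The numerical estimate. -/
lemma numeric_est (k m : ℕ) (u : ℝ) (hu : 20 ≤ u) (hk : (k : ℝ) = Real.exp (u ^ 7))
    (hm : (k : ℝ) / Real.exp u - 1 ≤ m) :
    ∃ J : ℕ, 0 < m ∧ ((((k : ℝ) + m) / m) ^ 3) ^ (J+1) < m ∧ 2 * k < (m - 2) * 2 ^ J := by
  have hu1 : (1 : ℝ) ≤ u := by linarith
  have hu6 : (20 : ℝ) ^ 6 ≤ u ^ 6 := by gcongr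
  have hu7 : 64000000 * u ≤ u ^ 7 := by
    have : u ^ 7 = u ^ 6 * u := by ring
    rw [this]; nlinarith
  have hu5 : (20 : ℝ) ^ 5 ≤ u ^ 5 := by gcongr
  have hu72 : 3200000 * u ^ 2 ≤ u ^ 7 := by
    have : u ^ 7 = u ^ 5 * u ^ 2 := by ring
    rw [this]; nlinarith [sq_nonneg u]
  have hq : (k : ℝ) / Real.exp u = Real.exp (u ^ 7 - u) := by rw [hk, Real.exp_sub]
  have hbig : (6 : ℝ) ≤ Real.exp (u ^ 7 - u) := by
    have := Real.add_one_le_exp (u ^ 7 - u)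
    nlinarith
  rw [hq] at hm
  -- m ≥ x/2 and m - 2 ≥ x/2
  have hm2 : Real.exp (u ^ 7 - u) / 2 ≤ (m : ℝ) - 2 := by linarith
  have hmpos : (0 : ℝ) < m := by linarith
  have hm0 : 0 < m := by exact_mod_cast hmpos
  have hm2' : 2 ≤ m := by
    have : (2 : ℝ) ≤ m := by linarith
    exact_mod_cast this
  have hE : Real.exp (u ^ 7) = Real.exp (u ^ 7 - u) * Real.exp u := by
    rw [← Real.exp_add]; ring_nf
  have hEx : Real.exp (u ^ 7 - u) = Real.exp (u ^ 7) / Real.exp u := by rw [Real.exp_sub]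
  have e1 : (2 : ℝ) ≤ Real.exp 1 := by
    have := Real.add_one_le_exp (1 : ℝ); linarith
  have eu : (1 : ℝ) ≤ Real.exp u := Real.one_le_exp (by linarith)
  refine ⟨⌈2 * u⌉₊ + 3, hm0, ?_, ?_⟩
  · set J := ⌈2 * u⌉₊ + 3 with hJ
    have hJle : (J : ℝ) ≤ 2 * u + 4 := by
      have := Nat.ceil_lt_add_one (a := 2 * u) (by linarith)
      rw [hJ]; push_cast; linarith
    have hK : ((k : ℝ) + m) / m ≤ Real.exp (2 * u) := by
      rw [div_le_iff₀ hmpos, hk, hE]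
      have h1 : Real.exp (u ^ 7 - u) ≤ 2 * m := by linarith
      have h2 : Real.exp (2 * u) = Real.exp u * Real.exp u := by rw [← Real.exp_add]; ring_nf
      have h3 : (3 : ℝ) ≤ Real.exp u := by
        have := Real.add_one_le_exp u; linarith
      rw [h2]
      have h4 : Real.exp (u ^ 7 - u) * Real.exp u ≤ 2 * m * Real.exp u := by gcongr
      have h5 : (m : ℝ) ≤ m * Real.exp u := by nlinarith
      have h6 : 3 * (m * Real.exp u) ≤ Real.exp u * (m * Real.exp u) := by
        have : 0 ≤ m * Real.exp u := by positivity
        nlinarith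
      nlinarith
    have hlow : Real.exp (u ^ 7 - u - 1) ≤ m := by
      rw [Real.exp_sub _ 1]
      calc Real.exp (u ^ 7 - u) / Real.exp 1 ≤ Real.exp (u ^ 7 - u) / 2 := by gcongr
        _ ≤ m := by linarith
    refine lt_of_lt_of_le ?_ hlow
    have h0 : 0 ≤ ((k : ℝ) + m) / m := by positivity
    calc ((((k : ℝ) + m) / m) ^ 3) ^ (J+1) ≤ (Real.exp (2 * u) ^ 3) ^ (J+1) := by gcongr
      _ = Real.exp (((J+1 : ℕ) : ℝ) * (((3 : ℕ) : ℝ) * (2 * u))) := by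
          rw [Real.exp_nat_mul, Real.exp_nat_mul]
      _ < Real.exp (u ^ 7 - u - 1) := by
          apply Real.exp_lt_exp.2
          push_cast
          nlinarith
  · have hpow : 8 * Real.exp u ≤ (2 : ℝ) ^ (⌈2 * u⌉₊ + 3) := by
      rw [pow_add]
      have h1 : Real.exp u ≤ (2 : ℝ) ^ ⌈2 * u⌉₊ := by
        rw [← Real.rpow_natCast]
        calc Real.exp u ≤ Real.exp (Real.log 2 * (2 * u)) := by
              apply Real.exp_le_exp.2
              have := Real.log_two_gt_d9
              nlinarith
          _ = (2 : ℝ) ^ (2 * u) := by rw [Real.rpow_def_of_pos (by norm_num)]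
          _ ≤ _ := by
            apply Real.rpow_le_rpow_of_exponent_le (by norm_num)
            exact Nat.le_ceil _
      nlinarith
    have : (2 * k : ℝ) < ((m : ℝ) - 2) * 2 ^ (⌈2 * u⌉₊ + 3) := by
      have h1 : Real.exp (u ^ 7 - u) / 2 * (8 * Real.exp u) ≤
          ((m : ℝ) - 2) * 2 ^ (⌈2 * u⌉₊ + 3) := by gcongr; linarith
      have h2 : Real.exp (u ^ 7 - u) / 2 * (8 * Real.exp u) = 4 * k := by rw [hk, hE]; ring
      have : (0 : ℝ) < k := by rw [hk]; positivity
      linarith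
    have h' : ((2 * k : ℕ) : ℝ) < (((m - 2) * 2 ^ (⌈2 * u⌉₊ + 3) : ℕ) : ℝ) := by
      push_cast [Nat.cast_sub hm2']
      exact this
    exact_mod_cast h'

section Upper

lemma parity_sum {n : ℕ} (a b : Fin n → ℤ)
    (h : (fun j => ((a j : ℤ) : ZMod 2)) = (fun j => ((b j : ℤ) : ZMod 2))) :
    ∃ w : Fin n → ℤ, a + b = 2 • w := by
  have : ∀ j, ∃ w : ℤ, a j + b j = 2 * w := by
    intro j
    have hj := congrFun h j
    have h2 := (ZMod.intCast_eq_intCast_iff_dvd_sub (a j) (b j) 2).1 hj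
    obtain ⟨c, hc⟩ := h2
    exact ⟨a j + c, by push_cast at hc; linarith⟩
  choose w hw using this
  refine ⟨w, funext fun j => ?_⟩
  simp [hw j]

lemma upper_bound (n k : ℕ) (u : ℝ) (hu : 20 ≤ u) (hk : (k : ℝ) = Real.exp (u ^ 7))
    (V : Set (Fin n → ℝ)) (hVl : V ⊆ lat n) (hV : ConvexPos V) (hVf : V.Finite)
    (hs : V.ncard = ⌊(k : ℝ) / Real.exp u * 2 ^ n⌋₊) : k + 1 ≤ (iconv V \ V).ncard := by
  classical
  by_contra hcon
  have hBk : (iconv V \ V).ncard ≤ k := by omega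
  have hBf : (iconv V \ V).Finite := (iconv_finite V hVf).subset Set.sdiff_subset
  set Vz : Finset (Fin n → ℤ) := (hVf.preimage toR_inj.injOn).toFinset with hVz
  set B : Finset (Fin n → ℤ) := (hBf.preimage toR_inj.injOn).toFinset with hB
  have memV : ∀ x, x ∈ Vz ↔ toR x ∈ V := by intro x; simp [hVz]
  have memB : ∀ x, x ∈ B ↔ toR x ∈ convexHull ℝ V ∧ toR x ∉ V := by
    intro x
    have : toR x ∈ lat n := (mem_lat_iff _).2 ⟨x, rfl⟩
    simp [hB, iconv, this]
  have cardV : Vz.card = V.ncard := by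
    rw [← Set.ncard_coe_finset, hVz, Set.Finite.coe_toFinset]
    apply Set.ncard_preimage_of_injective_subset_range toR_inj
    intro x hx
    exact (mem_lat_iff x).1 (hVl hx)
  have cardB : B.card ≤ k := by
    refine le_trans (le_of_eq ?_) hBk
    rw [← Set.ncard_coe_finset, hB, Set.Finite.coe_toFinset]
    apply Set.ncard_preimage_of_injective_subset_range toR_inj
    intro x hx
    exact (mem_lat_iff x).1 hx.1.2
  -- pigeonhole
  have h2n : (0 : ℝ) < 2 ^ n := by positivity
  obtain ⟨c, -, hc⟩ := Finset.exists_le_card_fiber_of_nsmul_le_card_of_maps_to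
    (s := Vz) (t := (Finset.univ : Finset (Fin n → ZMod 2)))
    (f := fun x => fun j => ((x j : ℤ) : ZMod 2)) (b := (Vz.card : ℝ) / 2 ^ n)
    (fun _ _ => Finset.mem_univ _) Finset.univ_nonempty (by
      rw [nsmul_eq_mul]
      simp only [Finset.card_univ, Fintype.card_pi, ZMod.card, Finset.prod_const, Fintype.card_fin]
      push_cast
      rw [mul_div_cancel₀ _ h2n.ne'])
  set A := Vz.filter (fun x => (fun j => ((x j : ℤ) : ZMod 2)) = c) with hA
  have hAV : ∀ x ∈ A, toR x ∈ V := fun x hx => (memV x).1 (Finset.mem_filter.1 hx).1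
  have hApar : ∀ x ∈ A, ∀ y ∈ A, ∃ w : Fin n → ℤ, x + y = 2 • w := fun x hx y hy =>
    parity_sum x y ((Finset.mem_filter.1 hx).2.trans (Finset.mem_filter.1 hy).2.symm)
  have hmlow : (k : ℝ) / Real.exp u - 1 ≤ (A.card : ℝ) := by
    refine le_trans ?_ hc
    rw [cardV, hs, le_div_iff₀ h2n]
    have h1 := Nat.lt_floor_add_one ((k : ℝ) / Real.exp u * 2 ^ n)
    have h2 : (1 : ℝ) ≤ 2 ^ n := one_le_pow₀ (by norm_num)
    nlinarith
  obtain ⟨J, hm0, hlarge, hJ⟩ := numeric_est k A.card u hu hk hmlow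
  have hfin := core_comb A B A.card k J rfl cardB ?_ ?_ ?_ hm0 hlarge
  · omega
  · intro a ha b hb hab
    obtain ⟨w, hw⟩ := hApar a ha b hb
    refine ⟨w, ?_, hw⟩
    rw [memB]
    refine midpoint_notMem hV (subset_convexHull ℝ V (hAV a ha)) (subset_convexHull ℝ V (hAV b hb))
      (fun h => hab (toR_inj h)) ?_
    funext j
    have := congrFun hw j
    simp only [Pi.add_apply, Pi.smul_apply, toR, smul_eq_mul, nsmul_eq_mul] at this ⊢
    exact_mod_cast this
  · intro p hp q hq s hs hpq hsp hsq v hv i hi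
    obtain ⟨w, hw⟩ := hApar s hs p hp
    refine ⟨w + i • v, ?_, ?_⟩
    · rw [memB]
      have hi' : (i : ℝ) / 2 ^ J ≤ 1 := by
        rw [div_le_one (by positivity)]
        exact_mod_cast hi.le
      have hvj : ∀ j, (q j : ℝ) - p j = 2 ^ (J+1) * v j := by
        intro j
        have := congrFun hv j
        simp only [Pi.sub_apply, Pi.smul_apply, nsmul_eq_mul] at this
        exact_mod_cast this
      have hreq : toR (p + (2 * i) • v) = (1 - (i : ℝ) / 2 ^ J) • toR p + ((i : ℝ) / 2 ^ J) • toR q := by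
        funext j
        simp only [toR, Pi.add_apply, Pi.smul_apply, smul_eq_mul]
        simp only [nsmul_eq_mul]
        push_cast
        have h1 : (q j : ℝ) = p j + 2 ^ (J+1) * v j := by linarith [hvj j]
        rw [h1, pow_succ]
        field_simp
        ring
      have hrc : ∀ S : Set (Fin n → ℝ), toR p ∈ S → toR q ∈ S →
          toR (p + (2 * i) • v) ∈ convexHull ℝ S := by
        intro S h1 h2
        rw [hreq]
        exact convex_convexHull ℝ S (subset_convexHull ℝ S h1) (subset_convexHull ℝ S h2)
          (by linarith) (by positivity) (by ring)
      refine midpoint_notMem hV (subset_convexHull ℝ V (hAV s hs))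
        (hrc V (hAV p hp) (hAV q hq)) ?_ ?_
      · intro h
        apply hV _ (hAV s hs)
        rw [h]
        apply hrc
        · rw [← h]
          exact ⟨hAV p hp, fun h' => hsp (toR_inj h').symm⟩
        · rw [← h]
          exact ⟨hAV q hq, fun h' => hsq (toR_inj h').symm⟩
      · funext j
        have := congrFun hw j
        simp only [Pi.add_apply, Pi.smul_apply, toR, smul_eq_mul] at this ⊢
        simp only [nsmul_eq_mul] at this ⊢
        have h' : (s j : ℝ) + p j = 2 * w j := by exact_mod_cast this
        push_cast
        linarith
    · rw [hw, smul_add, mul_smul]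
  · intro a ha v hv i j hi hij h1 h2
    have hi0 : (0 : ℝ) < i := by exact_mod_cast hi
    have hij0 : (i : ℝ) < j := by exact_mod_cast hij
    have hj0 : (0 : ℝ) < j := hi0.trans hij0
    have hinj : ∀ x y : ℕ, a + x • v = a + y • v → x = y := by
      intro x y h
      have h' : x • v = y • v := add_left_cancel h
      obtain ⟨l, hl⟩ := Function.ne_iff.1 hv
      have h2 := congrFun h' l
      simp only [Pi.smul_apply] at h2
      simp only [nsmul_eq_mul] at h2
      exact_mod_cast mul_right_cancel₀ hl h2
    apply hV _ (hAV _ h1)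
    have heq : toR (a + i • v) = (1 - (i : ℝ) / j) • toR a + ((i : ℝ) / j) • toR (a + j • v) := by
      funext l
      simp only [toR, Pi.add_apply, Pi.smul_apply, smul_eq_mul]
      simp only [nsmul_eq_mul]
      push_cast
      field_simp
      ring
    have hmem1 : toR a ∈ V \ {toR (a + i • v)} := by
      refine ⟨hAV a ha, fun h => ?_⟩
      have := hinj 0 i (by simpa using toR_inj h)
      omega
    have hmem2 : toR (a + j • v) ∈ V \ {toR (a + i • v)} := by
      refine ⟨hAV _ h2, fun h => ?_⟩
      have := hinj j i (toR_inj h)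
      omega
    have hcv := convex_convexHull ℝ (V \ {toR (a + i • v)}) (subset_convexHull ℝ _ hmem1)
      (subset_convexHull ℝ _ hmem2) (show 0 ≤ 1 - (i : ℝ) / j by
        rw [sub_nonneg, div_le_one hj0]; exact hij0.le) (show 0 ≤ (i : ℝ) / j by positivity) (by ring)
    rw [← heq] at hcv
    exact hcv

end Upper

section Helly

variable {n : ℕ}

lemma convex_lt_union (f : (Fin n → ℝ) →ₗ[ℝ] ℝ) (p : Fin n → ℝ) :
    Convex ℝ ({x | f x < f p} ∪ {p}) := by
  intro x hx y hy a b ha hb hab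
  rcases ha.eq_or_lt with rfl | ha
  · have : b = 1 := by linarith
    subst this
    simpa using hy
  rcases hb.eq_or_lt with rfl | hb
  · have : a = 1 := by linarith
    subst this
    simpa using hx
  have hp : f p = a * f p + b * f p := by rw [← add_mul, hab, one_mul]
  rcases hx with hx | hx <;> rcases hy with hy | hy
  · left
    simp only [Set.mem_ofPred_eq, map_add, map_smul, smul_eq_mul] at hx hy ⊢
    rw [hp]
    have := mul_lt_mul_of_pos_left hx ha
    have := mul_lt_mul_of_pos_left hy hb
    linarith
  · left
    rw [Set.mem_singleton_iff] at hy
    subst hy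
    simp only [Set.mem_ofPred_eq, map_add, map_smul, smul_eq_mul] at hx ⊢
    have := mul_lt_mul_of_pos_left hx ha
    linarith
  · left
    rw [Set.mem_singleton_iff] at hx
    subst hx
    simp only [Set.mem_ofPred_eq, map_add, map_smul, smul_eq_mul] at hy ⊢
    have := mul_lt_mul_of_pos_left hy hb
    linarith
  · right
    rw [Set.mem_singleton_iff] at hx hy ⊢
    subst hx
    subst hy
    rw [← add_smul, hab, one_smul]

lemma hoffman {ι : Type*} [Fintype ι] [DecidableEq ι] (φ : ι → (Fin n → ℝ) →ₗ[ℝ] ℝ) (b : ι → ℝ)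
    (v : ι → Fin n → ℝ) (hv : ∀ i, v i ∈ lat n) (hvi : ∀ i, b i < φ i (v i))
    (hvj : ∀ i j, j ≠ i → φ j (v i) ≤ b j) :
    ∃ w : ι → (Fin n → ℝ), Function.Injective w ∧ Set.range w ⊆ lat n ∧ ConvexPos (Set.range w) ∧
      iconv (Set.range w) \ Set.range w ⊆ {x | x ∈ lat n ∧ ∀ i, φ i x ≤ b i} := by
  classical
  have hWf := iconv_finite (Set.range v) (Set.finite_range v)
  set W := hWf.toFinset with hW
  have hWm : ∀ x, x ∈ W ↔ x ∈ convexHull ℝ (Set.range v) ∧ x ∈ lat n := by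
    intro x; rw [hW, Set.Finite.mem_toFinset]; rfl
  have hvW : ∀ i, v i ∈ W := fun i => (hWm _).2 ⟨subset_convexHull ℝ _ ⟨i, rfl⟩, hv i⟩
  -- valid choices
  let valid : (ι → Fin n → ℝ) → Prop := fun f => (∀ i, b i < φ i (f i)) ∧
    ∀ x ∈ W, (∀ j, φ j x < φ j (f j)) → ∀ j, φ j x ≤ b j
  have hinit : ∃ f, f ∈ (Fintype.piFinset (fun _ : ι => W)).filter valid := by
    have : ∀ i, ∃ x ∈ W.filter (fun x => b i < φ i x),
        ∀ y ∈ W.filter (fun x => b i < φ i x), φ i x ≤ φ i y := fun i =>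
      Finset.exists_min_image _ _ ⟨v i, Finset.mem_filter.2 ⟨hvW i, hvi i⟩⟩
    choose f hf hf' using this
    refine ⟨f, Finset.mem_filter.2 ⟨Fintype.mem_piFinset.2 fun i => (Finset.mem_filter.1 (hf i)).1,
      fun i => (Finset.mem_filter.1 (hf i)).2, ?_⟩⟩
    intro x hx hlt j
    by_contra hh
    push Not at hh
    have := hf' j x (Finset.mem_filter.2 ⟨hx, hh⟩)
    linarith [hlt j]
  obtain ⟨f, hf, hmax⟩ := Finset.exists_max_image _ (fun f => ∑ i, φ i (f i)) hinit
  obtain ⟨hfW, hfb, hfv⟩ := Finset.mem_filter.1 hf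
  rw [Fintype.mem_piFinset] at hfW
  have step : ∀ i, ∃ x ∈ W, φ i x = φ i (f i) ∧ ∀ j, j ≠ i → φ j x < φ j (f j) := by
    intro i
    obtain ⟨x, hx, hxmin⟩ := Finset.exists_min_image
      (W.filter (fun x => (∀ j, j ≠ i → φ j x < φ j (f j)) ∧ ¬ ∀ j, φ j x ≤ b j)) (φ i)
      ⟨v i, Finset.mem_filter.2 ⟨hvW i, fun j hj => (hvj i j hj).trans_lt (hfb j),
        fun h => absurd (h i) (not_le.2 (hvi i))⟩⟩
    obtain ⟨hxW, hxlt, hxn⟩ := Finset.mem_filter.1 hx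
    refine ⟨x, hxW, ?_, hxlt⟩
    have hge : φ i (f i) ≤ φ i x := by
      by_contra hh
      push Not at hh
      apply hxn
      apply hfv x hxW
      intro j
      by_cases hj : j = i
      · subst hj; exact hh
      · exact hxlt j hj
    have hg : Function.update f i x ∈ (Fintype.piFinset (fun _ : ι => W)).filter valid := by
      refine Finset.mem_filter.2 ⟨Fintype.mem_piFinset.2 fun j => ?_, fun j => ?_, ?_⟩
      · by_cases hj : j = i
        · subst hj; simpa using hxW
        · simpa [Function.update_of_ne hj] using hfW j
      · by_cases hj : j = i
        · subst hj; simpa using (hfb j).trans_le hge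
        · simpa [Function.update_of_ne hj] using hfb j
      · intro y hy hylt
        by_contra hh
        have h1 := hxmin y (Finset.mem_filter.2 ⟨hy, fun j hj => by
          simpa [Function.update_of_ne hj] using hylt j, hh⟩)
        have h2 := hylt i
        rw [Function.update_self] at h2
        linarith
    have hle := hmax _ hg
    have hsum : ∑ j, φ j (Function.update f i x j) = ∑ j, φ j (f j) + (φ i x - φ i (f i)) := by
      rw [← sub_eq_iff_eq_add', ← Finset.sum_sub_distrib]
      rw [Finset.sum_eq_single i]
      · simp
      · intro j _ hj
        simp [Function.update_of_ne hj]
      · intro h; exact absurd (Finset.mem_univ i) h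
    rw [hsum] at hle
    linarith
  choose w hwW hweq hwlt using step
  have hne : ∀ i j, i ≠ j → φ i (w j) < φ i (w i) := by
    intro i j hij
    rw [hweq i]
    exact hwlt j i hij
  have hinj : Function.Injective w := by
    intro i j h
    by_contra hij
    have := hne i j hij
    rw [h] at this
    exact lt_irrefl _ this
  refine ⟨w, hinj, ?_, ?_, ?_⟩
  · rintro _ ⟨i, rfl⟩
    exact ((hWm _).1 (hwW i)).2
  · rintro _ ⟨i, rfl⟩ hcon
    have hsub : convexHull ℝ (Set.range w \ {w i}) ⊆ {x | φ i x < φ i (w i)} := by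
      apply convexHull_min
      · rintro _ ⟨⟨j, rfl⟩, hj⟩
        exact hne i j (fun h => hj (by rw [h]; rfl))
      · exact convex_halfSpace_lt (φ i).isLinear _
    have hlt : φ i (w i) < φ i (w i) := hsub hcon
    exact lt_irrefl _ hlt
  · rintro x ⟨⟨hxc, hxl⟩, hxn⟩
    refine ⟨hxl, hfv x ((hWm x).2 ⟨?_, hxl⟩) ?_⟩
    · refine convexHull_min ?_ (convex_convexHull ℝ _) hxc
      rintro _ ⟨i, rfl⟩
      exact ((hWm _).1 (hwW i)).1
    · intro i
      have hsub : convexHull ℝ (Set.range w) ⊆ {x | φ i x < φ i (w i)} ∪ {w i} := by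
        apply convexHull_min _ (convex_lt_union (φ i) (w i))
        rintro _ ⟨j, rfl⟩
        by_cases hij : i = j
        · right; rw [hij]; rfl
        · left; exact hne i j hij
      rcases hsub hxc with h | h
      · rw [← hweq i]; exact h
      · exact absurd ⟨i, h.symm⟩ hxn

lemma helly_of_ell (k l : ℕ) (hl : ∀ V : Set (Fin n → ℝ), V ⊆ lat n → ConvexPos V → V.Finite →
    V.ncard = l → k + 1 ≤ (iconv V \ V).ncard) : HellyBound n k l := by
  classical
  intro m A b hPf hPk
  obtain ⟨I, hI, hImin⟩ := Finset.exists_min_image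
    ((Finset.univ : Finset (Finset (Fin m))).filter (fun I : Finset (Fin m) =>
      intPts (polyI A b (↑I : Set (Fin m))) = intPts (polyI A b Set.univ))) Finset.card
    ⟨Finset.univ, by simp⟩
  have hIeq := (Finset.mem_filter.1 hI).2
  refine ⟨I, ?_, hIeq⟩
  by_contra hlt
  push Not at hlt
  let φ : I → (Fin n → ℝ) →ₗ[ℝ] ℝ := fun i => ∑ j, A i j • LinearMap.proj j
  have hφ : ∀ i x, φ i x = ∑ j, A i j * x j := by intro i x; simp [φ]
  have hex : ∀ i : I, ∃ x, x ∈ lat n ∧ b i < φ i x ∧ ∀ j : I, j ≠ i → φ j x ≤ b j := by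
    intro i
    have hne : ¬ intPts (polyI A b (↑(I.erase i) : Set (Fin m))) = intPts (polyI A b Set.univ) := by
      intro h
      have h1 := hImin (I.erase i) (Finset.mem_filter.2 ⟨Finset.mem_univ _, h⟩)
      have h2 := Finset.card_erase_lt_of_mem i.2
      omega
    rw [← hIeq] at hne
    have hsub : intPts (polyI A b (↑I : Set (Fin m))) ⊆ intPts (polyI A b (↑(I.erase i) : Set (Fin m))) := by
      rintro x ⟨hx, hx'⟩
      exact ⟨fun j hj => hx j (Finset.mem_of_mem_erase hj), hx'⟩
    have hns : ¬ intPts (polyI A b (↑(I.erase i) : Set (Fin m))) ⊆ intPts (polyI A b (↑I : Set (Fin m))) :=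
      fun h => hne (Set.Subset.antisymm h hsub)
    obtain ⟨x, hx, hxn⟩ := Set.not_subset.1 hns
    have hxj : ∀ j : I, j ≠ i → φ j x ≤ b j := by
      intro j hj
      rw [hφ]
      exact hx.1 j (Finset.mem_coe.2 (Finset.mem_erase.2 ⟨fun h => hj (Subtype.ext h), j.2⟩))
    refine ⟨x, hx.2, ?_, hxj⟩
    by_contra hh
    push Not at hh
    apply hxn
    refine ⟨fun j hj => ?_, hx.2⟩
    rw [← hφ ⟨j, hj⟩]
    by_cases hji : (⟨j, hj⟩ : I) = i
    · subst hji; exact hh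
    · exact hxj _ hji
  choose v hvl hvi hvj using hex
  obtain ⟨w, hwinj, hwl, hwc, hwP⟩ := hoffman φ (fun i => b i) v hvl hvi hvj
  have hcard : (Set.range w).ncard = I.card := by
    rw [← Set.image_univ, Set.ncard_image_of_injective _ hwinj, Set.ncard_univ]
    simp
  obtain ⟨V, hVsub, hVcard⟩ := Set.exists_subset_card_eq (s := Set.range w) (n := l) (by omega)
  have hVf : V.Finite := (Set.finite_range w).subset hVsub
  have h1 := hl V (hVsub.trans hwl) (hwc.mono hVsub) hVf hVcard
  have hsub : iconv V \ V ⊆ intPts (polyI A b Set.univ) := by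
    rintro x ⟨⟨hx, hxl⟩, hxn⟩
    have hxw : x ∉ Set.range w := by
      intro hxr
      refine hwc x hxr (convexHull_mono ?_ hx)
      intro y hy
      exact ⟨hVsub hy, fun h => hxn (by rw [← Set.mem_singleton_iff.1 h]; exact hy)⟩
    have := hwP ⟨⟨convexHull_mono hVsub hx, hxl⟩, hxw⟩
    rw [← hIeq]
    refine ⟨fun i hi => ?_, hxl⟩
    have h := this.2 ⟨i, hi⟩
    rw [hφ] at h
    exact h
  have h2 := Set.ncard_le_ncard hsub hPf
  omega

end Helly
/-- There are `C > 0` and a threshold `N` such that for all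
`n ≥ 1` and `k ≥ N`, `c(n,k) ≤ ℓ(n,k+1) ≤ (k / exp(C·(log k)^{1/7}))·2^n`. -/
theorem stmt6 :
    ∃ C : ℝ, 0 < C ∧ ∃ N : ℕ, ∀ n k : ℕ, 1 ≤ n → N ≤ k →
      cnk n k ≤ ellnk n (k + 1) ∧
      (ellnk n (k + 1) : ℝ) ≤
        ((k : ℝ) / Real.exp (C * Real.log k ^ ((1 : ℝ) / 7))) * (2 : ℝ) ^ n := by
  refine ⟨1, one_pos, ⌈Real.exp (20 ^ 7)⌉₊ + 1, ?_⟩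
  intro n k _ hk
  have hk1 : Real.exp (20 ^ 7) ≤ k := by
    refine (Nat.le_ceil _).trans ?_
    exact_mod_cast (Nat.le_succ _).trans hk
  have hkpos : (0 : ℝ) < k := (Real.exp_pos _).trans_le hk1
  have hlog : (20 : ℝ) ^ 7 ≤ Real.log k := (Real.le_log_iff_exp_le hkpos).2 hk1
  have hlog0 : 0 ≤ Real.log k := le_trans (by positivity) hlog
  set u := Real.log k ^ ((1 : ℝ) / 7) with hu
  have hu7 : u ^ 7 = Real.log k := by
    rw [hu, ← Real.rpow_natCast, ← Real.rpow_mul hlog0]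
    norm_num
  have hu0 : 0 ≤ u := Real.rpow_nonneg hlog0 _
  have hu20 : 20 ≤ u := by
    rw [← hu7] at hlog
    exact le_of_pow_le_pow_left₀ (by norm_num) hu0 hlog
  have hkexp : (k : ℝ) = Real.exp (u ^ 7) := by rw [hu7, Real.exp_log hkpos]
  have hmem := fun V hVl hV hVf hs => upper_bound n k u hu20 hkexp V hVl hV hVf hs
  constructor
  · apply Nat.sInf_le
    apply helly_of_ell
    exact Nat.sInf_mem (s := {s | ∀ V : Set (Fin n → ℝ), V ⊆ lat n → ConvexPos V → V.Finite →
      V.ncard = s → k + 1 ≤ (iconv V \ V).ncard}) ⟨_, hmem⟩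
  · rw [one_mul]
    refine le_trans ?_ (Nat.floor_le (by positivity))
    exact_mod_cast Nat.sInf_le (s := {s | ∀ V : Set (Fin n → ℝ), V ⊆ lat n → ConvexPos V →
      V.Finite → V.ncard = s → k + 1 ≤ (iconv V \ V).ncard}) hmem
end
end

section
/- Let 1 ≤ d ≤ n and let X ⊆ ℤ^n be a finite set with iconv(X) = X that is contained in a d-dimensional affine subspace of ℝ^n. Then c(X) ≤ c(d,|X|) + 2(2^n − 2). -/
open Pointwise

noncomputable section

lemma core_abs {ι α : Type} [Finite ι] (f : ι → α → ℝ) (F X : Set α) (hF : F.Finite)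
    (b : ι → ℝ) (hX : ∀ z ∈ F, (∀ i, f i z ≤ b i) ↔ z ∈ X)
    (hv : ∀ i, ∃ z ∈ F, b i < f i z ∧ ∀ j, j ≠ i → f j z ≤ b j) :
    ∃ (β : ι → ℝ) (v : ι → α), (∀ z ∈ F, (∀ i, f i z < β i) ↔ z ∈ X) ∧
      ∀ i, v i ∈ F ∧ f i (v i) = β i ∧ ∀ j, j ≠ i → f j (v i) < β j := by
  classical
  have := Fintype.ofFinite ι
  suffices H : ∀ T : Finset ι, ∃ (β : ι → ℝ) (v : ι → α),
      (∀ z ∈ F, (∀ i, f i z < β i) ↔ z ∈ X) ∧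
      ∀ i, v i ∈ F ∧ β i ≤ f i (v i) ∧ (∀ j, j ≠ i → f j (v i) < β j) ∧
        (i ∈ T → f i (v i) = β i) by
    obtain ⟨β, v, h1, h2⟩ := H Finset.univ
    exact ⟨β, v, h1, fun i => ⟨(h2 i).1, (h2 i).2.2.2 (Finset.mem_univ i), (h2 i).2.2.1⟩⟩
  intro T
  induction T using Finset.induction_on with
  | empty =>
    have hmin : ∀ i, ∃ β : ℝ, b i < β ∧ ∀ z ∈ F, b i < f i z → β ≤ f i z := by
      intro i
      obtain ⟨z0, hz0, hz1, -⟩ := hv i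
      obtain ⟨z, hz, hzm⟩ := Set.exists_min_image {z | z ∈ F ∧ b i < f i z} (f i)
        (hF.subset (fun z hz => hz.1)) ⟨z0, hz0, hz1⟩
      exact ⟨f i z, hz.2, fun w hw hw' => hzm w ⟨hw, hw'⟩⟩
    choose β hβ1 hβ2 using hmin
    have key : ∀ i, ∀ z ∈ F, f i z < β i ↔ f i z ≤ b i := by
      intro i z hz
      constructor
      · intro h
        by_contra h'
        exact absurd (hβ2 i z hz (not_le.mp h')) (not_le.mpr h)
      · intro h
        exact lt_of_le_of_lt h (hβ1 i)
    choose v hv1 hv2 hv3 using hv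
    refine ⟨β, v, ?_, ?_⟩
    · intro z hz
      rw [← hX z hz]
      exact forall_congr' fun i => key i z hz
    · intro i
      refine ⟨hv1 i, hβ2 i _ (hv1 i) (hv2 i), ?_, by simp⟩
      intro j hj
      exact (key j _ (hv1 i)).2 (hv3 i j hj)
  | insert i T hi ih =>
    obtain ⟨β, v, h1, h2⟩ := ih
    obtain ⟨z, hz, hzm⟩ := Set.exists_min_image
      {z | z ∈ F ∧ β i ≤ f i z ∧ ∀ j, j ≠ i → f j z < β j} (f i)
        (hF.subset (fun z hz => hz.1)) ⟨v i, (h2 i).1, (h2 i).2.1, (h2 i).2.2.1⟩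
    obtain ⟨hz1, hz2, hz3⟩ := hz
    have hle : ∀ j, β j ≤ Function.update β i (f i z) j := by
      intro j
      by_cases hj : j = i
      · subst hj; simpa using hz2
      · simp [hj]
    refine ⟨Function.update β i (f i z), Function.update v i z, ?_, ?_⟩
    · intro w hw
      rw [← h1 w hw]
      constructor
      · intro h
        have h' : ∀ j, j ≠ i → f j w < β j := by
          intro j hj
          simpa [hj] using h j
        intro j
        by_cases hj : j = i
        · subst hj
          by_contra hc
          have := hzm w ⟨hw, not_lt.mp hc, h'⟩
          have h3 := h j
          simp at h3
          linarith
        · exact h' j hj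
      · intro h j
        exact lt_of_lt_of_le (h j) (hle j)
    · intro k
      by_cases hk : k = i
      · subst hk
        simp only [Function.update_self]
        refine ⟨hz1, le_rfl, ?_, by simp⟩
        intro j hj
        simpa [hj] using hz3 j hj
      · simp only [Function.update_of_ne hk]
        refine ⟨(h2 k).1, (h2 k).2.1, ?_, ?_⟩
        · intro j hj
          exact lt_of_lt_of_le ((h2 k).2.2.1 j hj) (hle j)
        · intro h
          exact (h2 k).2.2.2 (Finset.mem_of_mem_insert_of_ne h hk)

lemma relax_real (T : Set ℝ) (hT : T.Finite) (β : ℝ) :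
    ∃ b, b < β ∧ ∀ t ∈ T, t < β → t ≤ b := by
  by_cases h : ∃ t ∈ T, t < β
  · obtain ⟨t0, ht0, ht1⟩ := h
    obtain ⟨z, hz, hzm⟩ := Set.exists_max_image {z | z ∈ T ∧ z < β} id
        (hT.subset (fun z hz => hz.1)) ⟨t0, ht0, ht1⟩
    exact ⟨z, hz.2, fun t ht ht' => hzm t ⟨ht, ht'⟩⟩
  · push Not at h
    exact ⟨β - 1, by linarith, fun t ht ht' => absurd (h t ht) (not_le.mpr ht')⟩

/-- evaluation of a linear functional on an integer vector -/
def evZ {n : ℕ} (a : Fin n → ℝ) (z : Fin n → ℤ) : ℝ := ∑ j, a j * (z j : ℝ)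

/-- cast of an integer vector -/
def castZ {n : ℕ} (z : Fin n → ℤ) : Fin n → ℝ := fun j => (z j : ℝ)

lemma castZ_inj {n : ℕ} : Function.Injective (castZ (n := n)) := by
  intro x y h
  funext j
  have := congrFun h j
  simpa [castZ] using this

lemma lat_eq (n : ℕ) : lat n = Set.range (castZ (n := n)) := by
  ext x
  constructor
  · intro h
    choose z hz using h
    exact ⟨z, funext fun j => (hz j).symm⟩
  · rintro ⟨z, rfl⟩ j
    exact ⟨z j, rfl⟩

lemma evZ_add {n : ℕ} (a : Fin n → ℝ) (z w : Fin n → ℤ) :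
    evZ a (z + w) = evZ a z + evZ a w := by
  simp [evZ, mul_add, Finset.sum_add_distrib]

/-- the functional `evZ` as an additive hom -/
def evHom {n : ℕ} (a : Fin n → ℝ) : (Fin n → ℤ) →+ ℝ :=
  { toFun := evZ a, map_zero' := by simp [evZ], map_add' := evZ_add a }

lemma evZ_comb {n d : ℕ} (a : Fin n → ℝ) (e : Fin d → Fin n → ℤ) (y : Fin d → ℤ) :
    evZ a (∑ t, y t • e t) = evZ (fun t => evZ a (e t)) y := by
  change evHom a _ = _
  rw [map_sum]
  simp only [map_zsmul, evZ]
  refine Finset.sum_congr rfl fun t _ => ?_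
  change (y t) • evZ a (e t) = _
  simp [evZ, mul_comm]

lemma intPts_poly {n m : ℕ} (A : Fin m → Fin n → ℝ) (b : Fin m → ℝ) (I : Set (Fin m)) :
    intPts (polyI A b I) = castZ '' {z | ∀ i ∈ I, evZ (A i) z ≤ b i} := by
  ext x
  simp only [intPts, lat_eq]
  constructor
  · rintro ⟨h, z, rfl⟩
    exact ⟨z, h, rfl⟩
  · rintro ⟨z, h, rfl⟩
    exact ⟨h, z, rfl⟩

lemma hellyZ {d k c : ℕ} (H : HellyBound d k c) {ι : Type} [Fintype ι]
    (A : ι → Fin d → ℝ) (b : ι → ℝ) (hfin : {z | ∀ i, evZ (A i) z ≤ b i}.Finite)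
    (hk : {z | ∀ i, evZ (A i) z ≤ b i}.ncard = k) :
    ∃ I : Finset ι, I.card ≤ c ∧
      ∀ z, (∀ i ∈ I, evZ (A i) z ≤ b i) → ∀ i, evZ (A i) z ≤ b i := by
  classical
  let e := Fintype.equivFin ι
  have hset : {z | ∀ i ∈ (Set.univ : Set (Fin (Fintype.card ι))),
      evZ (A (e.symm i)) z ≤ b (e.symm i)} = {z | ∀ i, evZ (A i) z ≤ b i} := by
    ext z
    simp only [Set.mem_ofPred_eq, Set.mem_univ, true_imp_iff]
    exact e.symm.forall_congr_left.trans (by simp)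
  obtain ⟨I, hI, hI2⟩ := H _ (fun i => A (e.symm i)) (fun i => b (e.symm i))
    (by rw [intPts_poly, hset]; exact hfin.image _)
    (by rw [intPts_poly, hset, Set.ncard_image_of_injective _ castZ_inj]; exact hk)
  refine ⟨I.map e.symm.toEmbedding, by simpa using hI, ?_⟩
  intro z hz
  rw [intPts_poly, intPts_poly, hset] at hI2
  have := castZ_inj.image_injective hI2
  have hz' : z ∈ {z | ∀ i ∈ (I : Set (Fin (Fintype.card ι))),
      evZ (A (e.symm i)) z ≤ b (e.symm i)} := by
    intro i hi
    exact hz _ (Finset.mem_map_of_mem _ hi)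
  rw [this] at hz'
  exact hz'

lemma box_finite (n : ℕ) (R : ℤ) : {z : Fin n → ℤ | ∀ j, |z j| ≤ R}.Finite := by
  refine (Set.finite_Icc (fun _ : Fin n => -R) (fun _ => R)).subset ?_
  intro z hz
  exact ⟨fun j => (abs_le.mp (hz j)).1, fun j => (abs_le.mp (hz j)).2⟩

lemma exists_box {n : ℕ} (Y : Set (Fin n → ℤ)) (hY : Y.Finite) :
    ∃ R : ℤ, ∀ z ∈ Y, ∀ j, |z j| ≤ R := by
  refine ⟨∑ z ∈ hY.toFinset, ∑ j, |z j|, ?_⟩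
  intro z hz j
  calc |z j| ≤ ∑ j, |z j| :=
        Finset.single_le_sum (f := fun j => |z j|) (fun _ _ => abs_nonneg _) (Finset.mem_univ j)
    _ ≤ _ := Finset.single_le_sum (f := fun z : Fin n → ℤ => ∑ j, |z j|)
        (fun _ _ => Finset.sum_nonneg fun _ _ => abs_nonneg _) (hY.mem_toFinset.mpr hz)

lemma box_mid {n : ℕ} {R : ℤ} {x y w : Fin n → ℤ} (hx : ∀ j, |x j| ≤ R) (hy : ∀ j, |y j| ≤ R)
    (h : w + w = x + y) : ∀ j, |w j| ≤ R := by
  intro j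
  have h1 := abs_le.mp (hx j)
  have h2 := abs_le.mp (hy j)
  have h3 : w j + w j = x j + y j := congrFun h j
  rw [abs_le]
  omega

lemma core {n : ℕ} {ι : Type} [Finite ι] (A : ι → Fin n → ℝ) (b : ι → ℝ)
    (X : Set (Fin n → ℤ)) (hfin : X.Finite) (hX : ∀ z, (∀ i, evZ (A i) z ≤ b i) ↔ z ∈ X)
    (hv : ∀ i, ∃ z, z ∉ X ∧ ∀ j, j ≠ i → evZ (A j) z ≤ b j) :
    ∃ (R : ℤ) (b' : ι → ℝ) (v : ι → Fin n → ℤ),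
      (∀ z : Fin n → ℤ, (∀ j, |z j| ≤ R) → ((∀ i, evZ (A i) z ≤ b' i) ↔ z ∈ X)) ∧
      (∀ x ∈ X, ∀ j, |x j| ≤ R) ∧ (∀ i j, |v i j| ≤ R) ∧
      (∀ i, b' i < evZ (A i) (v i)) ∧ (∀ i j, j ≠ i → evZ (A j) (v i) ≤ b' j) ∧
      (∀ i j w, i ≠ j → w + w = v i + v j → w ∈ X) ∧
      (∀ i x w, x ∈ X → w + w = v i + x → w ∈ X) := by
  choose u hu1 hu2 using hv
  obtain ⟨R, hR⟩ := exists_box (X ∪ Set.range u) (hfin.union (Set.finite_range u))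
  set F : Set (Fin n → ℤ) := {z | ∀ j, |z j| ≤ R} with hFdef
  have hF : F.Finite := box_finite n R
  have hu3 : ∀ i, b i < evZ (A i) (u i) := by
    intro i
    by_contra h
    apply hu1 i
    rw [← hX]
    intro j
    by_cases hj : j = i
    · subst hj; exact not_lt.mp h
    · exact hu2 i j hj
  obtain ⟨β, v, h1, h2⟩ := core_abs (fun i z => evZ (A i) z) F X hF b (fun z _ => hX z)
    (fun i => ⟨u i, hR _ (Or.inr ⟨i, rfl⟩), hu3 i, hu2 i⟩)
  choose b' hb1 hb2 using fun i => relax_real (evZ (A i) '' F) (hF.image _) (β i)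
  have key : ∀ i, ∀ z ∈ F, evZ (A i) z ≤ b' i ↔ evZ (A i) z < β i := fun i z hz =>
    ⟨fun h => lt_of_le_of_lt h (hb1 i), fun h => hb2 i _ ⟨z, hz, rfl⟩ h⟩
  have hXF : ∀ x ∈ X, ∀ j, |x j| ≤ R := fun x hx => hR x (Or.inl hx)
  have hmid : ∀ (a : Fin n → ℝ) (w x y : Fin n → ℤ), w + w = x + y →
      evZ a w + evZ a w = evZ a x + evZ a y := by
    intro a w x y h
    rw [← evZ_add, ← evZ_add, h]
  refine ⟨R, b', v, ?_, hXF, fun i => (h2 i).1, ?_, ?_, ?_, ?_⟩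
  · intro z hz
    rw [← h1 z hz]
    exact forall_congr' fun i => key i z hz
  · intro i
    have := (h2 i).2.1
    have := hb1 i
    linarith
  · intro i j hj
    exact (key j _ (h2 i).1).2 ((h2 i).2.2 j hj)
  · intro i j w hij hw
    rw [← h1 w (box_mid (h2 i).1 (h2 j).1 hw)]
    intro k
    have e := hmid (A k) w _ _ hw
    by_cases hki : k = i
    · have := (h2 i).2.1
      have := (h2 j).2.2 i hij
      subst hki
      linarith
    · have := (h2 i).2.2 k hki
      by_cases hkj : k = j
      · have := (h2 j).2.1
        subst hkj
        linarith
      · have := (h2 j).2.2 k hkj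
        linarith
  · intro i x w hx hw
    rw [← h1 w (box_mid (h2 i).1 (hXF x hx) hw)]
    intro k
    have e := hmid (A k) w _ _ hw
    have hxk := (h1 x (hXF x hx)).2 hx k
    by_cases hki : k = i
    · have := (h2 i).2.1
      subst hki
      linarith
    · have := (h2 i).2.2 k hki
      linarith

/-- parity vector -/
def parZ {n : ℕ} (z : Fin n → ℤ) : Fin n → ZMod 2 := fun j => (z j : ZMod 2)

lemma exists_mid {n : ℕ} {x y : Fin n → ℤ} (h : parZ x = parZ y) : ∃ w, w + w = x + y := by
  refine ⟨fun j => (x j + y j) / 2, ?_⟩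
  funext j
  have h1 : ((x j : ℤ) : ZMod 2) = ((y j : ℤ) : ZMod 2) := congrFun h j
  rw [ZMod.intCast_eq_intCast_iff] at h1
  have h2 : x j % 2 = y j % 2 := h1
  simp only [Pi.add_apply]
  omega

lemma card_par (n : ℕ) : Fintype.card (Fin n → ZMod 2) = 2 ^ n := by simp

lemma card_bound {n : ℕ} {ι : Type} [Fintype ι] (X : Set (Fin n → ℤ)) (hfin : X.Finite)
    (v : ι → Fin n → ℤ) (hinj : Function.Injective v)
    (h1 : ∀ i j w, i ≠ j → w + w = v i + v j → w ∈ X) :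
    Fintype.card ι ≤ 2 ^ n * (X.ncard + 1) := by
  classical
  have := Finset.card_le_mul_card_image (f := fun i => parZ (v i)) (Finset.univ : Finset ι)
    (X.ncard + 1) (by
      intro p hp
      obtain ⟨i, -, hi⟩ := Finset.mem_image.mp hp
      set T := Finset.univ.filter (fun a => parZ (v a) = p) with hT
      have hiT : i ∈ T := by simp [hT, hi]
      rw [← Finset.card_erase_add_one hiT]
      refine Nat.add_le_add_right ?_ 1
      have hm : ∀ j, ∃ w, j ∈ T.erase i → w + w = v i + v j := by
        intro j
        by_cases hj : j ∈ T.erase i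
        · have : parZ (v i) = parZ (v j) := by
            have := (Finset.mem_filter.mp (Finset.mem_of_mem_erase hj)).2
            rw [this]; exact hi
          obtain ⟨w, hw⟩ := exists_mid this
          exact ⟨w, fun _ => hw⟩
        · exact ⟨0, fun h => absurd h hj⟩
      choose w hw using hm
      rw [Set.ncard_eq_toFinset_card X hfin]
      refine Finset.card_le_card_of_injOn w ?_ ?_
      · intro j hj
        rw [Finset.mem_coe] at hj
        rw [Finset.mem_coe, hfin.mem_toFinset]
        exact h1 i j _ (Finset.ne_of_mem_erase hj).symm (hw j hj)
      · intro j hj k hk hjk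
        have e1 := hw j hj
        have e2 := hw k hk
        rw [hjk, e2] at e1
        exact hinj (add_left_cancel e1.symm))
  have h2 : (Finset.univ.image (fun i => parZ (v i))).card ≤ 2 ^ n := by
    rw [← card_par]; exact Finset.card_le_univ _
  calc Fintype.card ι ≤ (X.ncard + 1) * _ := this
    _ ≤ (X.ncard + 1) * 2 ^ n := Nat.mul_le_mul_left _ h2
    _ = _ := Nat.mul_comm _ _

lemma v_inj {n : ℕ} {ι : Type} {A : ι → Fin n → ℝ} {b' : ι → ℝ} {v : ι → Fin n → ℤ}
    (h1 : ∀ i, b' i < evZ (A i) (v i)) (h2 : ∀ i j, j ≠ i → evZ (A j) (v i) ≤ b' j) :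
    Function.Injective v := by
  intro i j hij
  by_contra h
  have := h1 i
  have h3 := h2 j i h
  rw [← hij] at h3
  linarith

lemma helly_exists (d k : ℕ) : HellyBound d k (2 ^ d * (k + 1)) := by
  classical
  intro m A b hfin hk
  obtain ⟨I, hI, hmin⟩ := Set.exists_min_image
    {I : Finset (Fin m) | intPts (polyI A b (↑I : Set (Fin m))) = intPts (polyI A b Set.univ)}
    Finset.card (Set.toFinite _) ⟨Finset.univ, by simp⟩
  refine ⟨I, ?_, hI⟩
  have hI' : intPts (polyI A b (↑I : Set (Fin m))) = intPts (polyI A b Set.univ) := hI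
  rw [← hI', intPts_poly] at hfin hk
  rw [Set.ncard_image_of_injective _ castZ_inj] at hk
  have hfin' := hfin.of_finite_image castZ_inj.injOn
  set X : Set (Fin d → ℤ) := {z | ∀ i ∈ (I : Set (Fin m)), evZ (A i) z ≤ b i} with hXdef
  obtain ⟨R, b', v, h1, h2, h3, h4, h5, h6, h7⟩ := core (ι := I) (fun i => A i) (fun i => b i) X
    hfin' (by
      intro z
      constructor
      · intro h i hi
        exact h ⟨i, hi⟩
      · intro h i
        exact h i i.2) (by
      rintro ⟨i, hi⟩
      by_contra hc
      push Not at hc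
      have : intPts (polyI A b (↑(I.erase i) : Set (Fin m))) = intPts (polyI A b Set.univ) := by
        rw [← hI', intPts_poly, intPts_poly]
        congr 1
        ext z
        constructor
        · intro hz
          by_contra hzX
          obtain ⟨⟨j, hj⟩, hji, hj2⟩ := hc z hzX
          have hne : j ≠ i := fun h => hji (Subtype.ext h)
          have := hz j (Finset.mem_coe.mpr (Finset.mem_erase.mpr ⟨hne, hj⟩))
          exact absurd this (not_le.mpr hj2)
        · intro hz j hj
          exact hz j (Finset.mem_of_mem_erase hj)
      have h := hmin _ this
      have h' := Finset.card_erase_lt_of_mem hi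
      omega)
  have := card_bound X hfin' v (v_inj h4 h5) h6
  rw [hk] at this
  simpa using this

lemma cnk_spec (d k : ℕ) : HellyBound d k (cnk d k) :=
  Nat.sInf_mem (s := {c | HellyBound d k c}) ⟨_, helly_exists d k⟩

lemma side_count {n : ℕ} {ι : Type} [Fintype ι] (X : Set (Fin n → ℤ))
    (v : ι → Fin n → ℤ)
    (h1 : ∀ i j w, i ≠ j → w + w = v i + v j → w ∈ X)
    (h2 : ∀ i x w, x ∈ X → w + w = v i + x → w ∈ X)
    (g : (Fin n → ℤ) →+ ℝ) (c : ℝ) (hg : ∀ x ∈ X, g x = c)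
    (P : Finset (Fin n → ZMod 2)) (hP : ∀ p ∈ P, ∃ x ∈ X, parZ x = p)
    (J : Finset ι) (hJ : ∀ i ∈ J, c < g (v i)) : J.card + P.card ≤ 2 ^ n := by
  classical
  have hinj : Set.InjOn (fun i => parZ (v i)) J := by
    intro i hi j hj hij
    by_contra hne
    obtain ⟨w, hw⟩ := exists_mid hij
    have e1 := hg _ (h1 i j w hne hw)
    have e2 := congrArg g hw
    rw [map_add, map_add] at e2
    have := hJ i hi
    have := hJ j hj
    linarith
  rw [← Finset.card_image_of_injOn hinj, ← Finset.card_union_of_disjoint, ← card_par]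
  · exact Finset.card_le_univ _
  · rw [Finset.disjoint_left]
    intro p hp hp'
    obtain ⟨i, hi, rfl⟩ := Finset.mem_image.mp hp
    obtain ⟨x, hx, hxp⟩ := hP _ hp'
    obtain ⟨w, hw⟩ := exists_mid hxp.symm
    have e1 := hg _ (h2 i x w hx hw)
    have e2 := congrArg g hw
    rw [map_add, map_add] at e2
    have := hJ i hi
    have := hg x hx
    linarith

lemma castZ_sub {n : ℕ} (x y : Fin n → ℤ) : castZ (x - y) = castZ x - castZ y := by
  funext j; simp [castZ]

lemma castZ_add {n : ℕ} (x y : Fin n → ℤ) : castZ (x + y) = castZ x + castZ y := by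
  funext j; simp [castZ]

lemma outside_count {n : ℕ} {ι : Type} [Fintype ι] (X : Set (Fin n → ℤ))
    (v : ι → Fin n → ℤ)
    (h1 : ∀ i j w, i ≠ j → w + w = v i + v j → w ∈ X)
    (h2 : ∀ i x w, x ∈ X → w + w = v i + x → w ∈ X)
    (x0 : Fin n → ℤ) (W : Submodule ℝ (Fin n → ℝ)) (hX : ∀ x ∈ X, castZ (x - x0) ∈ W)
    (P : Finset (Fin n → ZMod 2)) (hP : ∀ p ∈ P, ∃ x ∈ X, parZ x = p)
    (J : Finset ι) (hJ : ∀ i ∈ J, castZ (v i - x0) ∉ W) :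
    J.card + 2 * P.card ≤ 2 * 2 ^ n := by
  classical
  obtain ⟨f, hf⟩ := Module.exists_dual_forall_apply_ne_zero (K := ℝ) (M := (Fin n → ℝ) ⧸ W)
    (fun i : J => W.mkQ (castZ (v i - x0))) (by
      intro i h
      have := (Submodule.Quotient.mk_eq_zero W).mp h
      exact hJ i i.2 this)
  let g : (Fin n → ℤ) →+ ℝ :=
    { toFun := fun z => f (W.mkQ (castZ z))
      map_zero' := by
        have : castZ (0 : Fin n → ℤ) = 0 := by funext j; simp [castZ]
        rw [this]; simp
      map_add' := fun x y => by rw [castZ_add]; simp }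
  have hgd : ∀ z, g z - g x0 = f (W.mkQ (castZ (z - x0))) := by
    intro z
    rw [← map_sub]; rfl
  have hgX : ∀ x ∈ X, g x = g x0 := by
    intro x hx
    have := hgd x
    rw [show W.mkQ (castZ (x - x0)) = 0 from (Submodule.Quotient.mk_eq_zero W).mpr (hX x hx),
      map_zero] at this
    linarith
  have a1 := side_count X v h1 h2 g (g x0) hgX P hP (J.filter (fun i => g x0 < g (v i)))
    (fun i hi => (Finset.mem_filter.mp hi).2)
  have a2 := side_count X v h1 h2 (-g) (-g x0) (fun x hx => by simp [hgX x hx]) P hP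
    (J.filter (fun i => ¬ g x0 < g (v i)))
    (fun i hi => by
      obtain ⟨hi1, hi2⟩ := Finset.mem_filter.mp hi
      have h3 := hf ⟨i, hi1⟩
      simp only at h3
      rw [← hgd] at h3
      have h4 : g (v i) < g x0 := lt_of_le_of_ne (not_lt.mp hi2) (fun h => h3 (by linarith))
      simpa using h4)
  have := Finset.card_filter_add_card_filter_not (s := J) (fun i => g x0 < g (v i))
  omega

/-- integer points of a subspace -/
def latSub {n : ℕ} (W : Submodule ℝ (Fin n → ℝ)) : Submodule ℤ (Fin n → ℤ) :=
    { carrier := {z | castZ z ∈ W}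
      zero_mem' := by
        have : castZ (0 : Fin n → ℤ) = 0 := by funext j; simp [castZ]
        change castZ (0 : Fin n → ℤ) ∈ W
        rw [this]; exact W.zero_mem
      add_mem' := fun {x y} hx hy => by
        change castZ (x + y) ∈ W
        rw [castZ_add]; exact W.add_mem hx hy
      smul_mem' := fun c x hx => by
        change castZ (c • x) ∈ W
        have : castZ (c • x) = (c : ℝ) • castZ x := by funext j; simp [castZ]
        rw [this]; exact W.smul_mem _ hx }

lemma basis_card_le {n r d : ℕ} (W : Submodule ℝ (Fin n → ℝ)) (hW : Module.finrank ℝ W ≤ d)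
    (u : Fin r → Fin n → ℤ) (hu : ∀ i, castZ (u i) ∈ W) (hli : LinearIndependent ℤ u) :
    r ≤ d := by
  have h2 := (linearIndependent_algebraMap_comp_iff (R := ℤ) (S := ℝ) (v := u)).2
  have h3 : (fun i => ⇑(algebraMap ℤ ℝ) ∘ u i) = fun i => castZ (u i) := by
    funext i j; simp [castZ]
  rw [h3] at h2
  have hliR := h2 hli
  have hliW : LinearIndependent ℝ (fun i => (⟨castZ (u i), hu i⟩ : W)) :=
    LinearIndependent.of_comp W.subtype hliR
  have := hliW.fintype_card_le_finrank
  simp only [Fintype.card_fin] at this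
  omega

lemma lattice_param {n d : ℕ} (W : Submodule ℝ (Fin n → ℝ)) (hW : Module.finrank ℝ W ≤ d) :
    ∃ (e : Fin d → Fin n → ℤ) (N : Finset (Fin d)),
      (∀ y : Fin d → ℤ, (∀ t ∈ N, y t = 0) → ∑ t, y t • e t = 0 → y = 0) ∧
      (∀ y : Fin d → ℤ, castZ (∑ t, y t • e t) ∈ W) ∧
      (∀ z, castZ z ∈ W → ∃ y : Fin d → ℤ, (∀ t ∈ N, y t = 0) ∧ ∑ t, y t • e t = z) := by
  obtain ⟨L, hL⟩ : ∃ L : Submodule ℤ (Fin n → ℤ), ∀ z, z ∈ L ↔ castZ z ∈ W :=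
    ⟨latSub W, fun z => Iff.rfl⟩
  obtain ⟨r, ⟨B⟩⟩ := Submodule.nonempty_basis_of_pid (Pi.basisFun ℤ (Fin n)) L
  have hli : LinearIndependent ℤ (fun i => (B i : Fin n → ℤ)) :=
    B.linearIndependent.map' L.subtype (by simp)
  have hr : r ≤ d := basis_card_le W hW _ (fun i => (hL _).1 (B i).2) hli
  obtain ⟨s, rfl⟩ := Nat.exists_eq_add_of_le hr
  refine ⟨Fin.append (fun i => (B i : Fin n → ℤ)) (fun _ => 0),
    Finset.univ.image (Fin.natAdd r), ?_, ?_, ?_⟩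
  · intro y hy hs
    rw [Fin.sum_univ_add] at hs
    simp only [Fin.append_left, Fin.append_right, smul_zero, Finset.sum_const_zero, add_zero] at hs
    have h0 := Fintype.linearIndependent_iff.mp hli _ hs
    funext t
    refine Fin.addCases (fun i => h0 i) (fun i => ?_) t
    exact hy _ (Finset.mem_image_of_mem _ (Finset.mem_univ i))
  · intro y
    rw [Fin.sum_univ_add]
    simp only [Fin.append_left, Fin.append_right, smul_zero, Finset.sum_const_zero, add_zero]
    have : ∑ i, y (Fin.castAdd s i) • (B i : Fin n → ℤ) ∈ L :=
      L.sum_mem fun i _ => L.smul_mem _ (B i).2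
    exact (hL _).1 this
  · intro z hz
    rw [← hL] at hz
    refine ⟨Fin.append (fun i => B.repr ⟨z, hz⟩ i) (fun _ => 0), ?_, ?_⟩
    · intro t ht
      obtain ⟨i, -, rfl⟩ := Finset.mem_image.mp ht
      simp
    · rw [Fin.sum_univ_add]
      simp only [Fin.append_left, Fin.append_right, smul_zero, Finset.sum_const_zero, add_zero]
      have := congrArg L.subtype (B.sum_repr ⟨z, hz⟩)
      rw [map_sum] at this
      simpa using this

lemma affine_count {n d c : ℕ} {ι : Type} [Fintype ι] (A : ι → Fin n → ℝ) (b : ι → ℝ)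
    (X : Set (Fin n → ℤ)) (hfin : X.Finite) (hX : ∀ z, (∀ i, evZ (A i) z ≤ b i) ↔ z ∈ X)
    (H : HellyBound d X.ncard c) (x0 : Fin n → ℤ)
    (W : Submodule ℝ (Fin n → ℝ)) (hW : Module.finrank ℝ W ≤ d)
    (hXW : ∀ x ∈ X, castZ (x - x0) ∈ W)
    (J : Finset ι) (v : ι → Fin n → ℤ) (hJ : ∀ i ∈ J, castZ (v i - x0) ∈ W)
    (hv1 : ∀ i ∈ J, b i < evZ (A i) (v i)) (hv2 : ∀ i ∈ J, ∀ j, j ≠ i → evZ (A j) (v i) ≤ b j) :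
    J.card ≤ c := by
  classical
  obtain ⟨e, N, h1, h2, h3⟩ := lattice_param W hW
  let A' : ι ⊕ (N × Bool) → Fin d → ℝ := Sum.elim (fun i t => evZ (A i) (e t))
    (fun p => Pi.single (p.1 : Fin d) (if p.2 then (1 : ℝ) else -1))
  let b' : ι ⊕ (N × Bool) → ℝ := Sum.elim (fun i => b i - evZ (A i) x0) (fun _ => 0)
  let φ : (Fin d → ℤ) → (Fin n → ℤ) := fun y => x0 + ∑ t, y t • e t
  have hA1 : ∀ i y, evZ (A' (Sum.inl i)) y ≤ b' (Sum.inl i) ↔ evZ (A i) (φ y) ≤ b i := by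
    intro i y
    simp only [A', b', φ, Sum.elim_inl, evZ_add, evZ_comb]
    constructor <;> intro h <;> linarith
  have hA2 : ∀ p y, evZ (A' (Sum.inr p)) y = (if p.2 then (1 : ℝ) else -1) * y p.1 := by
    intro p y
    simp [A', evZ, Pi.single_apply]
  have hA3 : ∀ y : Fin d → ℤ, (∀ t ∈ N, y t = 0) → ∀ p, evZ (A' (Sum.inr p)) y ≤ b' (Sum.inr p) := by
    intro y hy p
    rw [hA2, hy _ p.1.2]
    simp [b']
  have hchar : ∀ y, (∀ i, evZ (A' i) y ≤ b' i) ↔ (φ y ∈ X ∧ ∀ t ∈ N, y t = 0) := by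
    intro y
    constructor
    · intro h
      refine ⟨(hX _).1 fun i => (hA1 i y).1 (h _), fun t ht => ?_⟩
      have a := h (Sum.inr (⟨t, ht⟩, true))
      have a' := h (Sum.inr (⟨t, ht⟩, false))
      rw [hA2] at a a'
      simp [b'] at a a'
      exact le_antisymm a a'
    · rintro ⟨ha, hb⟩ (i | p)
      · exact (hA1 i y).2 ((hX _).2 ha i)
      · exact hA3 y hb p
  have hinj : Set.InjOn φ {y | ∀ i, evZ (A' i) y ≤ b' i} := by
    intro y hy y' hy' hyy
    have k1 := ((hchar y).1 hy).2
    have k2 := ((hchar y').1 hy').2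
    have : y - y' = 0 := by
      apply h1
      · intro t ht
        simp [k1 t ht, k2 t ht]
      · have := add_left_cancel hyy
        simp only [Pi.sub_apply, sub_smul, Finset.sum_sub_distrib]
        rw [this, sub_self]
    exact sub_eq_zero.mp this
  have himg : φ '' {y | ∀ i, evZ (A' i) y ≤ b' i} = X := by
    ext x
    constructor
    · rintro ⟨y, hy, rfl⟩
      exact ((hchar y).1 hy).1
    · intro hx
      obtain ⟨y, hy1, hy2⟩ := h3 _ (hXW x hx)
      have : φ y = x := by simp only [φ, hy2]; abel
      exact ⟨y, (hchar y).2 ⟨this ▸ hx, hy1⟩, this⟩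
  obtain ⟨I, hI1, hI2⟩ := hellyZ H A' b'
    (Set.Finite.of_finite_image (himg ▸ hfin) hinj)
    (by rw [← hinj.ncard_image, himg])
  refine le_trans ?_ hI1
  refine Finset.card_le_card_of_injOn Sum.inl ?_ Sum.inl_injective.injOn
  intro i hi
  by_contra hc
  obtain ⟨y, hy1, hy2⟩ := h3 _ (hJ i hi)
  have hφ : φ y = v i := by simp only [φ, hy2]; abel
  have := hI2 y (by
    rintro (j | p) hj
    · rw [hA1, hφ]
      refine hv2 i hi j ?_
      rintro rfl
      exact hc hj
    · exact hA3 y hy1 p) (Sum.inl i)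
  rw [hA1, hφ] at this
  exact absurd this (not_le.mpr (hv1 i hi))

lemma two_le_cnk {d : ℕ} (hd : 1 ≤ d) : 2 ≤ cnk d 1 := by
  classical
  let j0 : Fin d := ⟨0, hd⟩
  let A : Fin d × Bool → Fin d → ℝ := fun p => Pi.single p.1 (if p.2 then (1 : ℝ) else -1)
  have hA : ∀ p y, evZ (A p) y = (if p.2 then (1 : ℝ) else -1) * y p.1 := by
    intro p y
    simp [A, evZ, Pi.single_apply]
  have hset : {z | ∀ p, evZ (A p) z ≤ (fun _ => (0 : ℝ)) p} = {(0 : Fin d → ℤ)} := by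
    ext z
    constructor
    · intro h
      rw [Set.mem_singleton_iff]
      funext t
      have a := h (t, true)
      have a' := h (t, false)
      rw [hA] at a a'
      simp at a a'
      exact le_antisymm a a'
    · rintro rfl p
      rw [hA]; simp
  obtain ⟨I, hI1, hI2⟩ := hellyZ (cnk_spec d 1) A (fun _ => 0) (by rw [hset]; simp)
    (by rw [hset]; simp)
  have hmem : ∀ s : Bool, (j0, s) ∈ I := by
    intro s
    by_contra hc
    have := hI2 (Pi.single j0 (if s then 1 else -1)) (by
      rintro ⟨t, s'⟩ hp
      rw [hA]
      by_cases ht : t = j0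
      · subst ht
        have : s' ≠ s := by rintro rfl; exact hc hp
        cases s <;> cases s' <;> simp_all
      · simp [ht]) (j0, s)
    rw [hA] at this
    cases s <;> simp at this <;> linarith
  refine le_trans ?_ hI1
  have : ({(j0, true), (j0, false)} : Finset (Fin d × Bool)) ⊆ I := by
    intro p hp
    simp at hp
    rcases hp with rfl | rfl <;> exact hmem _
  have := Finset.card_le_card this
  rwa [Finset.card_pair (by simp)] at this

lemma exists_ne_par {n : ℕ} (X : Set (Fin n → ℤ)) (hfin : X.Finite)
    (hmid : ∀ x ∈ X, ∀ y ∈ X, ∀ w, w + w = x + y → w ∈ X)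
    (x : Fin n → ℤ) (hx : x ∈ X) (y : Fin n → ℤ) (hy : y ∈ X) (hxy : y ≠ x) :
    ∃ z ∈ X, parZ z ≠ parZ x := by
  obtain ⟨z, hz, hzm⟩ := Set.exists_min_image {z | z ∈ X ∧ z ≠ x} (fun z => ∑ j, |z j - x j|)
    (hfin.subset fun z hz => hz.1) ⟨y, hy, hxy⟩
  refine ⟨z, hz.1, fun hp => ?_⟩
  obtain ⟨w, hw⟩ := exists_mid hp
  have hwX := hmid _ hz.1 _ hx w hw
  have hj : ∀ j, w j + w j = z j + x j := fun j => congrFun hw j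
  have hne : w ≠ x := by
    rintro rfl
    apply hz.2
    exact (add_right_cancel hw).symm
  have h1 := hzm w ⟨hwX, hne⟩
  have h2 : ∑ j, |z j - x j| = 2 * ∑ j, |w j - x j| := by
    rw [Finset.mul_sum]
    refine Finset.sum_congr rfl fun j _ => ?_
    rw [show z j - x j = 2 * (w j - x j) by linarith [hj j], abs_mul]
    rfl
  have h3 : 0 < ∑ j, |w j - x j| := by
    obtain ⟨j, hj⟩ := Function.ne_iff.mp hne
    exact Finset.sum_pos' (fun _ _ => abs_nonneg _)
      ⟨j, Finset.mem_univ j, abs_pos.mpr (sub_ne_zero.mpr hj)⟩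
  linarith

/-- If `X ⊆ ℤ^n` is finite with `iconv(X) = X` and `X` is
contained in a `d`-dimensional affine subspace of `ℝ^n`, then
`c(X) ≤ c(d,|X|) + 2(2^n − 2)`; i.e., every non-redundant system of `m`
inequalities whose integer points are exactly `X` satisfies
`m ≤ c(d,|X|) + 2(2^n − 2)`. -/
theorem stmt8 {n d : ℕ} (hd : 1 ≤ d) (hdn : d ≤ n)
    (X : Set (Fin n → ℝ)) (hXlat : X ⊆ lat n) (hXfin : X.Finite)
    (hX : iconv X = X)
    (S : AffineSubspace ℝ (Fin n → ℝ))
    (hdim : Module.finrank ℝ S.direction = d) (hXS : X ⊆ (S : Set (Fin n → ℝ))) :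
    ∀ (m : ℕ) (A : Fin m → Fin n → ℝ) (b : Fin m → ℝ),
      NonRedundant A b → intPts (polyI A b Set.univ) = X →
      m ≤ cnk d X.ncard + 2 * (2 ^ n - 2) := by
  classical
  intro m A b hNR hXeq
  have hXeq' := hXeq
  rw [intPts_poly] at hXeq'
  set Y : Set (Fin n → ℤ) := {z | ∀ i ∈ (Set.univ : Set (Fin m)), evZ (A i) z ≤ b i} with hY
  have hYfin : Y.Finite :=
    Set.Finite.of_finite_image (f := castZ) (by rw [hXeq']; exact hXfin) castZ_inj.injOn
  have hcard : X.ncard = Y.ncard := by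
    rw [← hXeq', Set.ncard_image_of_injective _ castZ_inj]
  have hYchar : ∀ z, (∀ i, evZ (A i) z ≤ b i) ↔ z ∈ Y := by
    intro z
    exact ⟨fun h i _ => h i, fun h i => h i (Set.mem_univ i)⟩
  have hv : ∀ i, ∃ z, z ∉ Y ∧ ∀ j, j ≠ i → evZ (A j) z ≤ b j := by
    intro i
    obtain ⟨p, hp1, hp2⟩ := Set.exists_of_ssubset (hNR i)
    rw [intPts_poly] at hp1 hp2
    obtain ⟨z, hz, rfl⟩ := hp1
    refine ⟨z, fun h => hp2 ⟨z, h, rfl⟩, fun j hj => hz j ?_⟩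
    simpa using hj
  obtain ⟨R, b', v, h1, h2, h3, h4, h5, h6, h7⟩ := core A b Y hYfin hYchar hv
  have hvY : ∀ i, v i ∉ Y := by
    intro i hi
    have := (h1 _ (h3 i)).2 hi i
    exact absurd this (not_le.mpr (h4 i))
  rw [hcard]
  rcases Set.eq_empty_or_nonempty Y with hE | ⟨x0, hx0⟩
  · by_cases hn : n = 1
    · have hd1 : d = n := by omega
      subst hd1
      obtain ⟨I, hI1, hI2⟩ := hellyZ (cnk_spec d Y.ncard) A b
        (by simpa [hY] using hYfin) (by simp [hY])
      have hIu : I = Finset.univ := by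
        rw [Finset.eq_univ_iff_forall]
        intro i
        by_contra hi
        obtain ⟨z, hz1, hz2⟩ := hv i
        apply hz1
        rw [← hYchar]
        refine hI2 z fun j hj => hz2 j ?_
        rintro rfl
        exact hi hj
      rw [hIu] at hI1
      simp at hI1
      omega
    · have hb := card_bound Y hYfin v (v_inj h4 h5) h6
      rw [hE] at hb ⊢
      simp at hb
      have : 2 ^ 2 ≤ 2 ^ n := Nat.pow_le_pow_right (by norm_num) (by omega)
      omega
  · have hpow : 2 ^ 1 ≤ 2 ^ n := Nat.pow_le_pow_right (by norm_num) (by omega)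
    by_cases hone : ∃ y ∈ Y, y ≠ x0
    · obtain ⟨y, hy, hyx⟩ := hone
      have hmid : ∀ x ∈ Y, ∀ y ∈ Y, ∀ w, w + w = x + y → w ∈ Y := by
        intro x hx y hy w hw
        rw [← hYchar] at hx hy ⊢
        intro i
        have e := congrArg (evZ (A i)) hw
        rw [evZ_add, evZ_add] at e
        linarith [hx i, hy i]
      obtain ⟨z, hz, hzp⟩ := exists_ne_par Y hYfin hmid x0 hx0 y hy hyx
      have hYS : ∀ x ∈ Y, castZ x ∈ S := fun x hx => hXS (hXeq' ▸ ⟨x, hx, rfl⟩)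
      have hYW : ∀ x ∈ Y, castZ (x - x0) ∈ S.direction := by
        intro x hx
        rw [castZ_sub]
        exact AffineSubspace.vsub_mem_direction (hYS x hx) (hYS x0 hx0)
      have ho := outside_count Y v h6 h7 x0 S.direction hYW {parZ z, parZ x0} (by
        intro p hp
        simp at hp
        rcases hp with rfl | rfl
        · exact ⟨z, hz, rfl⟩
        · exact ⟨x0, hx0, rfl⟩)
        (Finset.univ.filter fun i => ¬ castZ (v i - x0) ∈ S.direction)
        (fun i hi => (Finset.mem_filter.mp hi).2)
      rw [Finset.card_pair hzp] at ho
      let A2 : Fin m ⊕ (Fin n × Bool) → Fin n → ℝ :=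
        Sum.elim A (fun p => Pi.single p.1 (if p.2 then (1 : ℝ) else -1))
      let b2 : Fin m ⊕ (Fin n × Bool) → ℝ := Sum.elim b' (fun _ => (R : ℝ))
      have hA2 : ∀ p y, evZ (A2 (Sum.inr p)) y = (if p.2 then (1 : ℝ) else -1) * y p.1 := by
        intro p y
        simp [A2, evZ, Pi.single_apply]
      have hbox : ∀ z : Fin n → ℤ, (∀ j, |z j| ≤ R) →
          ∀ p, evZ (A2 (Sum.inr p)) z ≤ b2 (Sum.inr p) := by
        rintro z hz ⟨j, s⟩
        rw [hA2]
        obtain ⟨k1, k2⟩ := abs_le.mp (hz j)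
        have k1' : -(R : ℝ) ≤ (z j : ℝ) := by exact_mod_cast k1
        have k2' : (z j : ℝ) ≤ (R : ℝ) := by exact_mod_cast k2
        cases s <;> simp [b2] <;> linarith
      have hchar2 : ∀ z, (∀ i, evZ (A2 i) z ≤ b2 i) ↔ z ∈ Y := by
        intro z
        constructor
        · intro h
          have hz : ∀ j, |z j| ≤ R := by
            intro j
            have a := h (Sum.inr (j, true))
            have a' := h (Sum.inr (j, false))
            rw [hA2] at a a'
            simp [b2] at a a'
            rw [abs_le]
            constructor
            · have : -(R : ℝ) ≤ (z j : ℝ) := by linarith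
              exact_mod_cast this
            · exact_mod_cast a
          exact (h1 z hz).1 fun i => h (Sum.inl i)
        · rintro hz (i | p)
          · exact (h1 z (h2 z hz)).2 hz i
          · exact hbox z (h2 z hz) p
      have hi := affine_count A2 b2 Y hYfin hchar2 (cnk_spec d Y.ncard) x0 S.direction hdim.le hYW
        ((Finset.univ.filter fun i => castZ (v i - x0) ∈ S.direction).map
          ⟨Sum.inl, Sum.inl_injective⟩) (Sum.elim v (fun _ => 0))
        (by
          intro i hi
          obtain ⟨k, hk, rfl⟩ := Finset.mem_map.mp hi
          exact (Finset.mem_filter.mp hk).2)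
        (by
          intro i hi
          obtain ⟨k, hk, rfl⟩ := Finset.mem_map.mp hi
          exact h4 k)
        (by
          intro i hi
          obtain ⟨k, hk, rfl⟩ := Finset.mem_map.mp hi
          rintro (j | p) hj
          · exact h5 k j (fun h => hj (congrArg Sum.inl h))
          · exact hbox _ (h3 k) p)
      rw [Finset.card_map] at hi
      have hsum := Finset.card_filter_add_card_filter_not (s := (Finset.univ : Finset (Fin m)))
        (fun i => castZ (v i - x0) ∈ S.direction)
      rw [Finset.card_univ, Fintype.card_fin] at hsum
      omega
    · push Not at hone
      have hY1 : Y = {x0} := by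
        ext y
        exact ⟨fun h => hone y h, fun h => h ▸ hx0⟩
      have ho := outside_count Y v h6 h7 x0 ⊥ (by
          intro x hx
          rw [hone x hx]
          rw [castZ_sub, sub_self]
          exact Submodule.zero_mem _) {parZ x0} (by
          intro p hp
          exact ⟨x0, hx0, (Finset.mem_singleton.mp hp).symm⟩) Finset.univ (by
          intro i _ hi
          rw [Submodule.mem_bot, castZ_sub, sub_eq_zero] at hi
          exact hvY i (castZ_inj hi ▸ hx0))
      have h2c := two_le_cnk hd
      rw [hY1, Set.ncard_singleton]
      simp at ho
      omega
end
end
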